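/- Let ω be a concave weight function, let U ⊆ ℝ^d be open, and let j be a positive integer. If f : U → ℂ is a function such that f^j and f^{j+1} belong to the Roumieu Braun–Meise–Taylor class E^{{ω}}(U), then f belongs to E^{{ω}}(U). -/

import Mathlib

open Set Filter Topology Metric
open scoped ENNReal NNReal Topology

noncomputable section

namespace JorisPaper

/-- The sequence `m` with `m_k = M_k / k!`. -/
def lc (M : ℕ → ℝ) (k : ℕ) : ℝ := M k / (Nat.factorial k : ℝ)

/-- A weight sequence: positive, log-convex, `M_0 = 1 ≤ M_1`, `M_k^{1/k} → ∞`. -/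
structure IsWeightSeq (M : ℕ → ℝ) : Prop where
  pos : ∀ k, 0 < M k
  first : M 0 = 1
  one_le : 1 ≤ M 1
  logconvex : ∀ k, 1 ≤ k → M k ^ 2 ≤ M (k - 1) * M (k + 1)
  root : Filter.Tendsto (fun k : ℕ => M k ^ ((1 : ℝ) / (k : ℝ))) atTop atTop

/-- `m_k^{1/k} → ∞`. -/
def RootsTendsto (m : ℕ → ℝ) : Prop :=
  Filter.Tendsto (fun k : ℕ => m k ^ ((1 : ℝ) / (k : ℝ))) atTop atTop

/-- `h_m(t) = inf_k m_k t^k` for `t > 0`, and `0` for `t ≤ 0`. -/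
def hfn (m : ℕ → ℝ) (t : ℝ) : ℝ := if t ≤ 0 then 0 else ⨅ k : ℕ, m k * t ^ k

/-- `Γ̄_m(t) = min {k | h_m(t) = m_k t^k}`. -/
def GammaUpper (m : ℕ → ℝ) (t : ℝ) : ℕ := sInf {k : ℕ | hfn m t = m k * t ^ k}

/-- `Γ̲_m(t) = min {k | m_{k+1}/m_k ≥ 1/t}`. -/
def GammaLower (m : ℕ → ℝ) (t : ℝ) : ℕ := sInf {k : ℕ | 1 / t ≤ m (k + 1) / m k}

/-- `mg(M,N) = sup_{j+k ≥ 1} (M_{j+k}/(N_j N_k))^{1/(j+k)}`, as an extended real. -/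
def mg (M N : ℕ → ℝ) : ℝ≥0∞ :=
  ⨆ (j : ℕ) (k : ℕ) (_ : 1 ≤ j + k),
    ENNReal.ofReal ((M (j + k) / (N j * N k)) ^ (((j : ℝ) + (k : ℝ))⁻¹))

/-- A weight matrix: a totally ordered (pointwise) family of weight sequences. -/
structure IsWeightMatrix (W : Set (ℕ → ℝ)) : Prop where
  weight : ∀ M ∈ W, IsWeightSeq M
  ordered : ∀ M ∈ W, ∀ N ∈ W, (∀ k, M k ≤ N k) ∨ (∀ k, N k ≤ M k)

/-- R-admissible weight matrix. -/
structure RAdmissible (W : Set (ℕ → ℝ)) : Prop where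
  matrix : IsWeightMatrix W
  roots : ∀ M ∈ W, RootsTendsto (lc M)
  gamma : ∀ M ∈ W, ∃ N ∈ W, ∃ C : ℝ, 1 ≤ C ∧
    ∀ t : ℝ, 0 < t → GammaUpper (lc N) (C * t) ≤ GammaLower (lc M) t
  mgrowth : ∀ M ∈ W, ∃ N ∈ W, mg M N < ⊤

/-- B-admissible weight matrix. -/
structure BAdmissible (W : Set (ℕ → ℝ)) : Prop where
  matrix : IsWeightMatrix W
  roots : ∀ M ∈ W, RootsTendsto (lc M)
  gamma : ∀ M ∈ W, ∃ N ∈ W, ∃ C : ℝ, 1 ≤ C ∧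
    ∀ t : ℝ, 0 < t → GammaUpper (lc M) (C * t) ≤ GammaLower (lc N) t
  mgrowth : ∀ M ∈ W, ∃ N ∈ W, mg N M < ⊤

/-- `‖f‖^M_{K,ρ} < ∞` (derivatives taken within `U`). -/
def SeqBoundedOn {E F : Type*} [NormedAddCommGroup E] [NormedSpace ℝ E]
    [NormedAddCommGroup F] [NormedSpace ℝ F]
    (M : ℕ → ℝ) (ρ : ℝ) (f : E → F) (U K : Set E) : Prop :=
  ∃ C : ℝ, ∀ x ∈ K, ∀ k : ℕ, ‖iteratedFDerivWithin ℝ k f U x‖ ≤ C * ρ ^ k * M k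

/-- `f ∈ B^M_ρ(V)`: smooth on `V` with global bounds `‖f‖^M_{V,ρ} < ∞`. -/
def GlobalClass {E F : Type*} [NormedAddCommGroup E] [NormedSpace ℝ E]
    [NormedAddCommGroup F] [NormedSpace ℝ F]
    (M : ℕ → ℝ) (ρ : ℝ) (f : E → F) (V : Set E) : Prop :=
  ContDiffOn ℝ (⊤ : ℕ∞) f V ∧ SeqBoundedOn M ρ f V V

/-- The Roumieu class `E^{{W}}(U)`. -/
def Roumieu {E F : Type*} [NormedAddCommGroup E] [NormedSpace ℝ E]
    [NormedAddCommGroup F] [NormedSpace ℝ F]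
    (W : Set (ℕ → ℝ)) (U : Set E) (f : E → F) : Prop :=
  ContDiffOn ℝ (⊤ : ℕ∞) f U ∧
    ∀ K ⊆ U, IsCompact K → ∃ M ∈ W, ∃ ρ : ℝ, 0 < ρ ∧ SeqBoundedOn M ρ f U K

/-- The Beurling class `E^{(W)}(U)`. -/
def Beurling {E F : Type*} [NormedAddCommGroup E] [NormedSpace ℝ E]
    [NormedAddCommGroup F] [NormedSpace ℝ F]
    (W : Set (ℕ → ℝ)) (U : Set E) (f : E → F) : Prop :=
  ContDiffOn ℝ (⊤ : ℕ∞) f U ∧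
    ∀ K ⊆ U, IsCompact K → ∀ M ∈ W, ∀ ρ : ℝ, 0 < ρ → SeqBoundedOn M ρ f U K

/-- The open ellipse `Ω_ε` with vertices `±cosh ε` and co-vertices `±i sinh ε`. -/
def Omega (ε : ℝ) : Set ℂ :=
  {z : ℂ | (z.re / Real.cosh ε) ^ 2 + (z.im / Real.sinh ε) ^ 2 < 1}

/-- `V_U = ⋃_{x ∈ U} (x + 𝔹)`. -/
def VU {E : Type*} [NormedAddCommGroup E] [NormedSpace ℝ E] (U : Set E) : Set E :=
  ⋃ x ∈ U, Metric.closedBall x 1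

/-- A weight function in the sense of Braun–Meise–Taylor. -/
structure IsWeightFunction (ω : ℝ → ℝ) : Prop where
  cont : ContinuousOn ω (Ici 0)
  mono : MonotoneOn ω (Ici 0)
  nonneg : ∀ t, 0 ≤ t → 0 ≤ ω t
  bigO : (fun t => ω (2 * t)) =O[atTop] ω
  littleO : ω =o[atTop] (fun t => t)
  logLittleO : Real.log =o[atTop] ω
  convex : ConvexOn ℝ (Ici 0) (fun t => ω (Real.exp t))

/-- The Young conjugate `φ*_ω(s) = sup_{t ≥ 0} (s t - ω(e^t))`. -/
def youngConj (ω : ℝ → ℝ) (s : ℝ) : ℝ :=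
  sSup {y : ℝ | ∃ t : ℝ, 0 ≤ t ∧ y = s * t - ω (Real.exp t)}

/-- The Roumieu class `E^{{ω}}(U)` for a weight function `ω`. -/
def RoumieuW {E F : Type*} [NormedAddCommGroup E] [NormedSpace ℝ E]
    [NormedAddCommGroup F] [NormedSpace ℝ F]
    (ω : ℝ → ℝ) (U : Set E) (f : E → F) : Prop :=
  ContDiffOn ℝ (⊤ : ℕ∞) f U ∧
    ∀ K ⊆ U, IsCompact K → ∃ C : ℝ, 0 < C ∧ ∃ ρ : ℝ, 0 < ρ ∧
      ∀ x ∈ K, ∀ k : ℕ, ‖iteratedFDerivWithin ℝ k f U x‖ ≤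
        C * Real.exp ((1 / ρ) * youngConj ω (ρ * k))

/-- The Beurling class `E^{(ω)}(U)` for a weight function `ω`. -/
def BeurlingW {E F : Type*} [NormedAddCommGroup E] [NormedSpace ℝ E]
    [NormedAddCommGroup F] [NormedSpace ℝ F]
    (ω : ℝ → ℝ) (U : Set E) (f : E → F) : Prop :=
  ContDiffOn ℝ (⊤ : ℕ∞) f U ∧
    ∀ K ⊆ U, IsCompact K → ∀ ρ : ℝ, 0 < ρ → ∃ C : ℝ, 0 < C ∧
      ∀ x ∈ K, ∀ k : ℕ, ‖iteratedFDerivWithin ℝ k f U x‖ ≤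
        C * Real.exp ((1 / ρ) * youngConj ω (ρ * k))

/-- A `C¹` function bounded by `M` whose derivative has its zeros in a finite set `Z` has total
variation at most `(#Z + 1) * (2 * M)`. -/
lemma integral_abs_deriv_le {A A' : ℝ → ℝ} {M : ℝ} (hA : ∀ x, HasDerivAt A (A' x) x)
    (hA' : Continuous A') (hM : ∀ x, |A x| ≤ M) (Z : Finset ℝ) :
    ∀ a b : ℝ, a ≤ b → (∀ x ∈ Ioo a b, A' x = 0 → x ∈ Z) →
      ∫ x in a..b, |A' x| ≤ (Z.card + 1) * (2 * M) := by
  have hM0 : 0 ≤ M := (abs_nonneg _).trans (hM 0)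
  have hint : ∀ u v : ℝ, IntervalIntegrable A' MeasureTheory.volume u v :=
    fun u v => hA'.intervalIntegrable u v
  induction Z using Finset.strongInduction with
  | H Z ih =>
  intro a b hab hZ
  by_cases hz : ∃ z ∈ Z, z ∈ Ioo a b
  · obtain ⟨z, hzZ, hz⟩ := hz
    have hl : Z.filter (· < z) ⊂ Z := Finset.filter_ssubset.2 ⟨z, hzZ, by simp⟩
    have hr : Z.filter (z < ·) ⊂ Z := Finset.filter_ssubset.2 ⟨z, hzZ, by simp⟩
    have h1 := ih _ hl a z hz.1.le (fun x hx h0 => by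
      simp only [Finset.mem_filter]
      exact ⟨hZ x ⟨hx.1, hx.2.trans hz.2⟩ h0, hx.2⟩)
    have h2 := ih _ hr z b hz.2.le (fun x hx h0 => by
      simp only [Finset.mem_filter]
      exact ⟨hZ x ⟨hz.1.trans hx.1, hx.2⟩ h0, hx.1⟩)
    have hcard : (Z.filter (· < z)).card + (Z.filter (z < ·)).card + 1 ≤ Z.card := by
      have hd : Disjoint (Z.filter (· < z)) (Z.filter (z < ·)) := by
        rw [Finset.disjoint_filter]; intro x _ h1 h2; linarith
      rw [← Finset.card_union_of_disjoint hd]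
      have hs : (Z.filter (· < z) ∪ Z.filter (z < ·)) ⊂ Z := by
        refine Finset.ssubset_iff_subset_ne.2 ⟨?_, fun h => ?_⟩
        · exact Finset.union_subset hl.1 hr.1
        · rw [← h] at hzZ; simp at hzZ
      exact Finset.card_lt_card hs
    rw [← intervalIntegral.integral_add_adjacent_intervals (hint a z).abs (hint z b).abs]
    have hcard' : (((Z.filter (· < z)).card : ℝ) + (Z.filter (z < ·)).card + 1) ≤ Z.card := by
      exact_mod_cast hcard
    nlinarith
  · push Not at hz
    have hne : ∀ x ∈ Ioo a b, A' x ≠ 0 := fun x hx h0 => hz x (hZ x hx h0) hx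
    have hbase : ∫ x in a..b, |A' x| ≤ 2 * M := by
      have hI : ∫ x in a..b, A' x = A b - A a :=
        intervalIntegral.integral_eq_sub_of_hasDerivAt (fun x _ => hA x) (hint a b)
      have hb := abs_le.1 (hM b)
      have ha := abs_le.1 (hM a)
      by_cases hpos : ∀ x ∈ Ioo a b, 0 ≤ A' x
      · have : ∫ x in a..b, |A' x| = ∫ x in a..b, A' x := by
          rw [intervalIntegral.integral_of_le hab, intervalIntegral.integral_of_le hab,
            MeasureTheory.integral_Ioc_eq_integral_Ioo, MeasureTheory.integral_Ioc_eq_integral_Ioo]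
          exact MeasureTheory.setIntegral_congr_fun measurableSet_Ioo
            (fun x hx => abs_of_nonneg (hpos x hx))
        rw [this, hI]; linarith
      · push Not at hpos
        obtain ⟨y, hy, hy0⟩ := hpos
        have hneg : ∀ x ∈ Ioo a b, A' x ≤ 0 := by
          intro x hx
          by_contra! hx0
          have hsub : uIcc x y ⊆ Ioo a b := ordConnected_Ioo.uIcc_subset hx hy
          obtain ⟨c, hc, hc0⟩ := intermediate_value_uIcc (hA'.continuousOn (s := uIcc x y))
            (show (0 : ℝ) ∈ uIcc (A' x) (A' y) from by
              rw [mem_uIcc]; right; exact ⟨hy0.le, hx0.le⟩)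
          exact hne c (hsub hc) hc0
        have : ∫ x in a..b, |A' x| = ∫ x in a..b, -A' x := by
          rw [intervalIntegral.integral_of_le hab, intervalIntegral.integral_of_le hab,
            MeasureTheory.integral_Ioc_eq_integral_Ioo, MeasureTheory.integral_Ioc_eq_integral_Ioo]
          exact MeasureTheory.setIntegral_congr_fun measurableSet_Ioo
            (fun x hx => abs_of_nonpos (hneg x hx))
        rw [this, intervalIntegral.integral_neg, hI]; linarith
    have : (0 : ℝ) ≤ Z.card := Nat.cast_nonneg _
    nlinarith

/-- The total variation of `arctan (R / r)` on `[0, 1]` for a real polynomial `R`. -/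
lemma integral_abs_derivative_mul_le (R : Polynomial ℝ) {N : ℕ} (hN : R.natDegree ≤ N) {r : ℝ}
    (hr : 0 < r) :
    ∫ s in (0 : ℝ)..1, |R.derivative.eval s| * (r / (R.eval s ^ 2 + r ^ 2)) ≤ (N + 1) * Real.pi := by
  have hpos : ∀ s, 0 < R.eval s ^ 2 + r ^ 2 := fun s => by positivity
  by_cases h0 : R.derivative = 0
  · simp only [h0, Polynomial.eval_zero, abs_zero, zero_mul, intervalIntegral.integral_zero]
    positivity
  have hA : ∀ s, HasDerivAt (fun s => Real.arctan (R.eval s / r))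
      (R.derivative.eval s * (r / (R.eval s ^ 2 + r ^ 2))) s := by
    intro s
    have h := ((R.hasDerivAt s).div_const r).arctan
    convert h using 1
    have := hpos s
    field_simp
    ring
  have hcont : Continuous fun s => R.derivative.eval s * (r / (R.eval s ^ 2 + r ^ 2)) := by
    refine (Polynomial.continuous _).mul (continuous_const.div ?_ fun s => (hpos s).ne')
    exact ((Polynomial.continuous _).pow 2).add continuous_const
  have h := integral_abs_deriv_le hA hcont (M := Real.pi / 2)
    (fun s => (abs_lt.2 ⟨by linarith [Real.neg_pi_div_two_lt_arctan (R.eval s / r)],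
      Real.arctan_lt_pi_div_two _⟩).le) R.derivative.roots.toFinset 0 1 zero_le_one
    (fun x _ hx => by
      rw [Multiset.mem_toFinset, Polynomial.mem_roots h0, Polynomial.IsRoot]
      rcases mul_eq_zero.1 hx with h | h
      · exact h
      · exact absurd h (div_pos hr (hpos x)).ne')
  have hcard : (R.derivative.roots.toFinset.card : ℝ) ≤ N := by
    have h1 := Multiset.toFinset_card_le R.derivative.roots
    have h2 := R.derivative.card_roots'
    have h3 := Polynomial.natDegree_derivative_le R
    exact_mod_cast h1.trans (h2.trans (h3.trans ((Nat.sub_le _ _).trans hN)))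
  calc _ = ∫ s in (0 : ℝ)..1, |R.derivative.eval s * (r / (R.eval s ^ 2 + r ^ 2))| := by
        refine intervalIntegral.integral_congr fun s _ => ?_
        simp only [abs_mul, abs_of_pos (div_pos hr (hpos s))]
    _ ≤ _ := h
    _ ≤ _ := by nlinarith [Real.pi_pos]

/-- The real polynomial obtained by taking real parts of the coefficients. -/
def rePoly (P : Polynomial ℂ) : Polynomial ℝ :=
  ∑ i ∈ Finset.range (P.natDegree + 1), Polynomial.monomial i (P.coeff i).re

lemma natDegree_rePoly_le (P : Polynomial ℂ) : (rePoly P).natDegree ≤ P.natDegree := by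
  refine Polynomial.natDegree_sum_le_of_forall_le _ _ fun i hi => ?_
  exact (Polynomial.natDegree_monomial_le _).trans (Nat.lt_succ_iff.1 (Finset.mem_range.1 hi))

lemma eval_rePoly (P : Polynomial ℂ) (s : ℝ) : (rePoly P).eval s = (P.eval (s : ℂ)).re := by
  rw [rePoly, Polynomial.eval_finsetSum, Polynomial.eval_eq_sum_range, Complex.re_sum]
  refine Finset.sum_congr rfl fun i _ => ?_
  rw [Polynomial.eval_monomial, ← Complex.ofReal_pow, Complex.re_mul_ofReal]

lemma eval_derivative_rePoly (P : Polynomial ℂ) (s : ℝ) :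
    (rePoly P).derivative.eval s = (P.derivative.eval (s : ℂ)).re := by
  have h1 := (rePoly P).hasDerivAt s
  have h2 := (P.hasDerivAt (s : ℂ)).real_of_complex
  have h3 : (fun s : ℝ => (rePoly P).eval s) = fun s : ℝ => (P.eval (s : ℂ)).re :=
    funext (eval_rePoly P)
  rw [← h3] at h2
  exact h1.unique h2

lemma integral_norm_derivative_mul_le_of_real (P : Polynomial ℂ) {N : ℕ} (hN : P.natDegree ≤ N)
    {r : ℝ} (hr : 0 < r) :
    ∫ s in (0 : ℝ)..1, ‖P.derivative.eval (s : ℂ)‖ * (r / (‖P.eval (s : ℂ)‖ ^ 2 + r ^ 2)) ≤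
      2 * (N + 1) * Real.pi := by
  have hpos : ∀ x : ℝ, 0 < x ^ 2 + r ^ 2 := fun x => by positivity
  set Q : Polynomial ℂ := Polynomial.C (-Complex.I) * P with hQ
  have hQd : Q.natDegree ≤ N := (Polynomial.natDegree_C_mul_le _ _).trans hN
  have h1 := integral_abs_derivative_mul_le (rePoly P) ((natDegree_rePoly_le P).trans hN) hr
  have h2 := integral_abs_derivative_mul_le (rePoly Q) ((natDegree_rePoly_le Q).trans hQd) hr
  have hc : ∀ R : Polynomial ℝ,
      Continuous fun s => |R.derivative.eval s| * (r / (R.eval s ^ 2 + r ^ 2)) := by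
    intro R
    refine (Polynomial.continuous _).abs.mul (continuous_const.div ?_ fun s => (hpos _).ne')
    exact ((Polynomial.continuous _).pow 2).add continuous_const
  have hcP : Continuous fun s : ℝ =>
      ‖P.derivative.eval (s : ℂ)‖ * (r / (‖P.eval (s : ℂ)‖ ^ 2 + r ^ 2)) := by
    refine ((Polynomial.continuous _).comp Complex.continuous_ofReal).norm.mul
      (continuous_const.div ?_ fun s => (hpos _).ne')
    exact (((Polynomial.continuous _).comp Complex.continuous_ofReal).norm.pow 2).add
      continuous_const
  calc _ ≤ ∫ s in (0 : ℝ)..1,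
        (|(rePoly P).derivative.eval s| * (r / ((rePoly P).eval s ^ 2 + r ^ 2)) +
          |(rePoly Q).derivative.eval s| * (r / ((rePoly Q).eval s ^ 2 + r ^ 2))) := by
        refine intervalIntegral.integral_mono_on zero_le_one (hcP.intervalIntegrable _ _)
          (((hc _).add (hc _)).intervalIntegrable _ _) fun s _ => ?_
        rw [eval_rePoly, eval_rePoly, eval_derivative_rePoly, eval_derivative_rePoly]
        have e1 : (Q.eval (s : ℂ)).re = (P.eval (s : ℂ)).im := by simp [hQ]
        have e2 : (Q.derivative.eval (s : ℂ)).re = (P.derivative.eval (s : ℂ)).im := by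
          simp [hQ]
        rw [e1, e2]
        set z := P.eval (s : ℂ)
        set w := P.derivative.eval (s : ℂ)
        have hz : ‖z‖ ^ 2 = z.re ^ 2 + z.im ^ 2 := by
          rw [Complex.sq_norm, Complex.normSq_apply]; ring
        have b1 : r / (‖z‖ ^ 2 + r ^ 2) ≤ r / (z.re ^ 2 + r ^ 2) := by
          apply div_le_div_of_nonneg_left hr.le (hpos _); rw [hz]; nlinarith [sq_nonneg z.im]
        have b2 : r / (‖z‖ ^ 2 + r ^ 2) ≤ r / (z.im ^ 2 + r ^ 2) := by
          apply div_le_div_of_nonneg_left hr.le (hpos _); rw [hz]; nlinarith [sq_nonneg z.re]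
        have b0 : 0 ≤ r / (‖z‖ ^ 2 + r ^ 2) := (div_pos hr (hpos _)).le
        calc ‖w‖ * (r / (‖z‖ ^ 2 + r ^ 2))
            ≤ (|w.re| + |w.im|) * (r / (‖z‖ ^ 2 + r ^ 2)) :=
              mul_le_mul_of_nonneg_right (Complex.norm_le_abs_re_add_abs_im w) b0
          _ = |w.re| * (r / (‖z‖ ^ 2 + r ^ 2)) + |w.im| * (r / (‖z‖ ^ 2 + r ^ 2)) := by ring
          _ ≤ _ := add_le_add (mul_le_mul_of_nonneg_left b1 (abs_nonneg _))
              (mul_le_mul_of_nonneg_left b2 (abs_nonneg _))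
    _ = _ := intervalIntegral.integral_add ((hc _).intervalIntegrable _ _)
        ((hc _).intervalIntegrable _ _)
    _ ≤ _ := by linarith

lemma integral_norm_derivative_mul_le (p : Polynomial ℂ) {N : ℕ} (hN : p.natDegree ≤ N)
    {r : ℝ} (hr : 0 < r) {e : ℂ} (he : ‖e‖ = 1) :
    ∫ s in (0 : ℝ)..1, ‖p.derivative.eval (s * e)‖ * (r / (‖p.eval (s * e)‖ ^ 2 + r ^ 2)) ≤
      2 * (N + 1) * Real.pi := by
  have h := integral_norm_derivative_mul_le_of_real (p.comp (Polynomial.C e * Polynomial.X))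
    (N := N) ?_ hr
  · refine le_of_eq_of_le (intervalIntegral.integral_congr fun s _ => ?_) h
    simp only [Polynomial.derivative_comp, Polynomial.eval_mul, Polynomial.eval_comp,
      Polynomial.eval_C, Polynomial.eval_X, Polynomial.derivative_C_mul, Polynomial.derivative_X,
      mul_one, norm_mul, he, mul_comm e]
  · refine Polynomial.natDegree_comp_le.trans ?_
    calc p.natDegree * (Polynomial.C e * Polynomial.X).natDegree ≤ p.natDegree * 1 :=
          Nat.mul_le_mul_left _ ((Polynomial.natDegree_C_mul_le _ _).trans Polynomial.natDegree_X_le)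
      _ ≤ N := by simpa using hN

open scoped ComplexConjugate in
/-- A smooth substitute for the quotient `v / p` on the unit disc. -/
def regQuot (p v : Polynomial ℂ) (r : ℝ) (w : ℂ) : ℂ :=
  v.eval w * conj (p.eval w) / (p.eval w * conj (p.eval w) + (r : ℂ) ^ 2)

lemma regQuot_denom_eq (b : ℂ) (r : ℝ) :
    b * (starRingEnd ℂ) b + (r : ℂ) ^ 2 = ((‖b‖ ^ 2 + r ^ 2 : ℝ) : ℂ) := by
  rw [Complex.mul_conj, Complex.normSq_eq_norm_sq]; push_cast; ring

lemma regQuot_denom_ne (b : ℂ) {r : ℝ} (hr : 0 < r) :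
    b * (starRingEnd ℂ) b + (r : ℂ) ^ 2 ≠ 0 := by
  rw [regQuot_denom_eq]
  exact_mod_cast (by positivity : ‖b‖ ^ 2 + r ^ 2 ≠ 0)

lemma differentiable_regQuot (p v : Polynomial ℂ) {r : ℝ} (hr : 0 < r) :
    Differentiable ℝ (regQuot p v r) := by
  have hv : Differentiable ℝ fun w : ℂ => v.eval w := v.differentiable.restrictScalars ℝ
  have hp : Differentiable ℝ fun w : ℂ => p.eval w := p.differentiable.restrictScalars ℝ
  have hc : Differentiable ℝ fun w : ℂ => (starRingEnd ℂ) (p.eval w) :=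
    Complex.conjCLE.differentiable.comp hp
  have hd : Differentiable ℝ fun w : ℂ => p.eval w * (starRingEnd ℂ) (p.eval w) + (r : ℂ) ^ 2 :=
    (hp.mul hc).add_const _
  have hn := fun w => regQuot_denom_ne (p.eval w) hr
  have := (hv.mul hc).mul (hd.inv hn)
  have heq : regQuot p v r = fun w => v.eval w * (starRingEnd ℂ) (p.eval w) *
      (p.eval w * (starRingEnd ℂ) (p.eval w) + (r : ℂ) ^ 2)⁻¹ := by
    funext w; rw [regQuot, div_eq_mul_inv]
  rw [heq]
  exact this

lemma hasDerivAt_mul_div {E a b c : ℝ → ℂ} {E' a' b' c' R : ℂ} {t : ℝ} (hE : HasDerivAt E E' t)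
    (ha : HasDerivAt a a' t) (hb : HasDerivAt b b' t) (hc : HasDerivAt c c' t)
    (h : b t * c t + R ≠ 0) :
    HasDerivAt (fun t => E t * (a t * c t / (b t * c t + R)))
      (E' * (a t * c t / (b t * c t + R)) + E t * (((a' * c t + a t * c') * (b t * c t + R) -
        a t * c t * (b' * c t + b t * c')) / (b t * c t + R) ^ 2)) t :=
  hE.mul ((ha.mul hc).div ((hb.mul hc).add_const R) h)

open scoped ComplexConjugate in
/-- Green's formula on the unit disc for `regQuot`, in polar coordinates. -/
lemma circle_integral_regQuot (p v : Polynomial ℂ) {r : ℝ} (hr : 0 < r) :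
    ∫ θ in (0 : ℝ)..(2 * Real.pi),
        Complex.I * Complex.exp (θ * Complex.I) * regQuot p v r (Complex.exp (θ * Complex.I)) =
      ∫ θ in (0 : ℝ)..(2 * Real.pi), ∫ s in (0 : ℝ)..1,
        2 * Complex.I * s * (v.eval (s * Complex.exp (θ * Complex.I)) *
          conj (p.derivative.eval (s * Complex.exp (θ * Complex.I))) * (r : ℂ) ^ 2 /
          (((‖p.eval (s * Complex.exp (θ * Complex.I))‖ ^ 2 + r ^ 2 : ℝ) : ℂ)) ^ 2) := by
  set u := regQuot p v r with hu
  have hud : Differentiable ℝ u := differentiable_regQuot p v hr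
  set e : ℝ → ℂ := fun θ => Complex.exp (θ * Complex.I) with he
  have hed : Differentiable ℝ e := by rw [he]; fun_prop
  have hed' : ∀ θ, HasDerivAt e (Complex.I * e θ) θ := by
    intro θ
    have h := ((Complex.ofRealCLM.hasDerivAt (x := θ)).mul_const Complex.I).cexp
    simp only [Complex.ofRealCLM_apply] at h
    convert h using 1
    simp only [he]; push_cast; ring
  set W : ℝ × ℝ → ℂ := fun z => (z.2 : ℂ) * e z.1 with hW
  have hWd : Differentiable ℝ W := by
    have h1 : Differentiable ℝ fun z : ℝ × ℝ => ((z.2 : ℝ) : ℂ) :=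
      Complex.ofRealCLM.differentiable.comp differentiable_snd
    exact h1.mul (hed.comp differentiable_fst)
  set f : ℝ × ℝ → ℂ := fun z => -e z.1 * u (W z) with hf
  set g : ℝ × ℝ → ℂ := fun z => (Complex.I * z.2 * e z.1) * u (W z) with hg
  have hfd : Differentiable ℝ f := (hed.comp differentiable_fst).neg.mul (hud.comp hWd)
  have hgd : Differentiable ℝ g := by
    have h1 : Differentiable ℝ fun z : ℝ × ℝ => ((z.2 : ℝ) : ℂ) :=
      Complex.ofRealCLM.differentiable.comp differentiable_snd
    exact ((h1.const_mul _).mul (hed.comp differentiable_fst)).mul (hud.comp hWd)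
  set D : ℝ × ℝ → ℂ := fun z => 2 * Complex.I * z.2 * (v.eval (z.2 * e z.1) *
          conj (p.derivative.eval (z.2 * e z.1)) * (r : ℂ) ^ 2 /
          (((‖p.eval (z.2 * e z.1)‖ ^ 2 + r ^ 2 : ℝ) : ℂ)) ^ 2) with hD
  have hdiv : ∀ z : ℝ × ℝ, fderiv ℝ f z (1, 0) + fderiv ℝ g z (0, 1) = D z := by
    rintro ⟨θ, s⟩
    have hee : e θ * conj (e θ) = 1 := by
      rw [Complex.mul_conj, Complex.normSq_eq_norm_sq, he]
      simp [Complex.norm_exp_ofReal_mul_I]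
    have hWθ : HasDerivAt (fun θ => (s : ℂ) * e θ) (s * (Complex.I * e θ)) θ :=
      (hed' θ).const_mul _
    have hWs : HasDerivAt (fun s : ℝ => (s : ℂ) * e θ) (e θ) s := by
      simpa using (Complex.ofRealCLM.hasDerivAt (x := s)).mul_const (e θ)
    have hpθ := (p.hasDerivAt ((s : ℂ) * e θ)).comp θ hWθ
    have hps := (p.hasDerivAt ((s : ℂ) * e θ)).comp s hWs
    have hvθ := (v.hasDerivAt ((s : ℂ) * e θ)).comp θ hWθ
    have hvs := (v.hasDerivAt ((s : ℂ) * e θ)).comp s hWs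
    have hcθ := hpθ.star
    have hcs := hps.star
    have hne := regQuot_denom_ne (p.eval ((s : ℂ) * e θ)) hr
    have h1 := hasDerivAt_mul_div (hed' θ).neg hvθ hpθ hcθ (R := (r : ℂ) ^ 2) hne
    have hE2 : HasDerivAt (fun s : ℝ => Complex.I * (s : ℂ) * e θ) (Complex.I * e θ) s := by
      simpa [mul_assoc] using hWs.const_mul Complex.I
    have h2 := hasDerivAt_mul_div hE2 hvs hps hcs (R := (r : ℂ) ^ 2) hne
    have h1' : HasDerivAt (fun t => f (t, s)) (fderiv ℝ f (θ, s) (1, 0)) θ :=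
      HasFDerivAt.comp_hasDerivAt (l := f) (f := fun t => (t, s)) θ (hfd (θ, s)).hasFDerivAt
        ((hasDerivAt_id θ).prodMk (hasDerivAt_const θ s))
    have h2' : HasDerivAt (fun t => g (θ, t)) (fderiv ℝ g (θ, s) (0, 1)) s :=
      HasFDerivAt.comp_hasDerivAt (l := g) (f := fun t => (θ, t)) s (hgd (θ, s)).hasFDerivAt
        ((hasDerivAt_const s θ).prodMk (hasDerivAt_id s))
    rw [h1'.unique h1, h2'.unique h2, hD]
    simp only [Function.comp_apply, ← regQuot_denom_eq, Complex.star_def, map_mul,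
      Complex.conj_I, Complex.conj_ofReal, Pi.neg_apply]
    generalize v.eval ((s : ℂ) * e θ) = a at *
    generalize p.eval ((s : ℂ) * e θ) = b at *
    generalize v.derivative.eval ((s : ℂ) * e θ) = a' at *
    generalize conj (p.derivative.eval ((s : ℂ) * e θ)) = c' at *
    generalize p.derivative.eval ((s : ℂ) * e θ) = b' at *
    generalize conj (e θ) = E' at *
    generalize conj b = c at *
    field_simp
    linear_combination (2 * a * r ^ 2 * s * c' * ((b * c + (r : ℂ) ^ 2) ^ 2)⁻¹) * hee
  have hDc : Continuous D := by
    have h1 : Continuous fun z : ℝ × ℝ => ((z.2 : ℝ) : ℂ) :=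
      Complex.continuous_ofReal.comp continuous_snd
    have hWc : Continuous W := hWd.continuous
    refine (continuous_const.mul h1).mul (Continuous.div ?_ ?_ ?_)
    · exact ((v.continuous.comp hWc).mul
        (Complex.continuous_conj.comp (p.derivative.continuous.comp hWc))).mul continuous_const
    · exact (Complex.continuous_ofReal.comp
        (((p.continuous.comp hWc).norm.pow 2).add continuous_const)).pow 2
    · intro z
      exact pow_ne_zero 2 (by exact_mod_cast (by positivity :
        ‖p.eval ((z.2 : ℂ) * e z.1)‖ ^ 2 + r ^ 2 ≠ 0))
  have key := MeasureTheory.integral2_divergence_prod_of_hasFDerivAt_off_countable f g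
    (fderiv ℝ f) (fderiv ℝ g) 0 0 (2 * Real.pi) 1 ∅ countable_empty hfd.continuous.continuousOn
    hgd.continuous.continuousOn (fun z _ => (hfd z).hasFDerivAt) (fun z _ => (hgd z).hasFDerivAt)
    (by
      simp only [hdiv]
      exact hDc.continuousOn.integrableOn_compact (isCompact_uIcc.prod isCompact_uIcc))
  simp only [hdiv] at key
  have hper : ∀ s, f (2 * Real.pi, s) = f (0, s) := by
    intro s
    have : e (2 * Real.pi) = e 0 := by simp [he]
    simp only [hf, hW, this]
  have hg0 : ∀ θ, g (θ, 0) = 0 := fun θ => by simp [hg]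
  have hg1 : ∀ θ, g (θ, 1) = Complex.I * e θ * u (e θ) := fun θ => by simp [hg, hW]
  simp only [hper, hg0, hg1, intervalIntegral.integral_zero, sub_zero, add_sub_cancel_right] at key
  rw [← key]

lemma exists_pow_eq_sqrt_add {B τ : ℝ} (hτ : 0 < τ) {j : ℕ} (hj : 1 ≤ j) :
    ∃ Y : ℝ, τ ≤ Y ∧ B ≤ Y ^ j ∧ Y ^ (2 * j) = B ^ 2 + (τ ^ j) ^ 2 := by
  have hj0 : j ≠ 0 := by lia
  set S := Real.sqrt (B ^ 2 + (τ ^ j) ^ 2) with hS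
  have hS2 : S ^ 2 = B ^ 2 + (τ ^ j) ^ 2 := Real.sq_sqrt (by positivity)
  have hS0 : 0 ≤ S := Real.sqrt_nonneg _
  have hY : (S ^ ((j : ℝ)⁻¹)) ^ j = S := Real.rpow_inv_natCast_pow hS0 hj0
  refine ⟨S ^ ((j : ℝ)⁻¹), ?_, ?_, ?_⟩
  · refine (pow_le_pow_iff_left₀ hτ.le (Real.rpow_nonneg hS0 _) hj0).1 ?_
    rw [hY]
    exact Real.le_sqrt_of_sq_le (by nlinarith)
  · rw [hY]
    exact Real.le_sqrt_of_sq_le (by nlinarith [sq_nonneg (τ ^ j)])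
  · rw [mul_comm, pow_mul, hY, hS2]

lemma mul_div_sq_le_of_pow_le {A B τ : ℝ} (hA : 0 ≤ A) (hB : 0 ≤ B) (hτ : 0 < τ) {j : ℕ}
    (hj : 1 ≤ j) (h : A ^ j ≤ B ^ (j + 1) + τ ^ (j * (j + 1))) :
    A * (τ ^ j) ^ 2 / (B ^ 2 + (τ ^ j) ^ 2) ^ 2 ≤ 2 * τ * (τ ^ j / (B ^ 2 + (τ ^ j) ^ 2)) := by
  obtain ⟨Y, hτY, hBY, hY⟩ := exists_pow_eq_sqrt_add (B := B) hτ hj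
  have hY0 : 0 < Y := hτ.trans_le hτY
  have hr : 0 < τ ^ j := by positivity
  have hA2 : A ≤ 2 * Y ^ (j + 1) := by
    refine (pow_le_pow_iff_left₀ hA (by positivity) (by lia : j ≠ 0)).1 ?_
    have h1 : B ^ (j + 1) ≤ Y ^ (j * (j + 1)) := by
      rw [pow_mul]; exact pow_le_pow_left₀ hB hBY _
    have h2 : τ ^ (j * (j + 1)) ≤ Y ^ (j * (j + 1)) := pow_le_pow_left₀ hτ.le hτY _
    have h3 : (2 : ℝ) ≤ 2 ^ j := by
      simpa using pow_le_pow_right₀ (by norm_num : (1 : ℝ) ≤ 2) hj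
    rw [mul_pow, ← pow_mul, mul_comm (j + 1) j]
    have : 0 < Y ^ (j * (j + 1)) := by positivity
    nlinarith
  have hX : 0 < B ^ 2 + (τ ^ j) ^ 2 := by positivity
  have hmain : A * τ ^ j ≤ 2 * τ * (B ^ 2 + (τ ^ j) ^ 2) := by
    obtain ⟨i, rfl⟩ : ∃ i, j = i + 1 := ⟨j - 1, by lia⟩
    have h1 : τ ^ i ≤ Y ^ i := pow_le_pow_left₀ hτ.le hτY _
    rw [← hY]
    calc A * τ ^ (i + 1) ≤ (2 * Y ^ (i + 1 + 1)) * τ ^ (i + 1) :=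
          mul_le_mul_of_nonneg_right hA2 hr.le
      _ = 2 * τ * Y ^ (i + 2) * τ ^ i := by ring
      _ ≤ 2 * τ * Y ^ (i + 2) * Y ^ i := mul_le_mul_of_nonneg_left h1 (by positivity)
      _ = _ := by ring
  rw [div_le_iff₀ (by positivity)]
  have : 2 * τ * (τ ^ j / (B ^ 2 + (τ ^ j) ^ 2)) * (B ^ 2 + (τ ^ j) ^ 2) ^ 2 =
      2 * τ * (B ^ 2 + (τ ^ j) ^ 2) * τ ^ j := by field_simp
  rw [this]
  nlinarith

lemma mul_div_le_of_pow_le {A B τ : ℝ} (hA : 0 ≤ A) (hτ : 0 < τ) {j : ℕ}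
    (hj : 1 ≤ j) (h : A ^ j ≤ B + τ ^ j) :
    A * (τ ^ j) ^ 2 / (B ^ 2 + (τ ^ j) ^ 2) ≤ 2 * τ := by
  obtain ⟨Y, hτY, hBY, hY⟩ := exists_pow_eq_sqrt_add (B := B) hτ hj
  have hY0 : 0 < Y := hτ.trans_le hτY
  have hA2 : A ≤ 2 * Y := by
    refine (pow_le_pow_iff_left₀ hA (by positivity) (by lia : j ≠ 0)).1 ?_
    have h2 : τ ^ j ≤ Y ^ j := pow_le_pow_left₀ hτ.le hτY _
    have h3 : (2 : ℝ) ≤ 2 ^ j := by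
      simpa using pow_le_pow_right₀ (by norm_num : (1 : ℝ) ≤ 2) hj
    rw [mul_pow]
    have : 0 < Y ^ j := by positivity
    nlinarith
  rw [div_le_iff₀ (by positivity), ← hY]
  obtain ⟨i, rfl⟩ : ∃ i, j = i + 1 := ⟨j - 1, by lia⟩
  have h1 : τ ^ (2 * i + 1) ≤ Y ^ (2 * i + 1) := pow_le_pow_left₀ hτ.le hτY _
  calc A * (τ ^ (i + 1)) ^ 2 ≤ 2 * Y * (τ ^ (i + 1)) ^ 2 :=
        mul_le_mul_of_nonneg_right hA2 (by positivity)
    _ = 2 * τ * Y * τ ^ (2 * i + 1) := by ring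
    _ ≤ 2 * τ * Y * Y ^ (2 * i + 1) := mul_le_mul_of_nonneg_left h1 (by positivity)
    _ = _ := by ring

lemma norm_circle_integral_regQuot_le (p v : Polynomial ℂ) {N j : ℕ} (hN : p.natDegree ≤ N)
    (hj : 1 ≤ j) {τ : ℝ} (hτ : 0 < τ)
    (h : ∀ w : ℂ, ‖w‖ ≤ 1 → ‖v.eval w‖ ^ j ≤ ‖p.eval w‖ ^ (j + 1) + τ ^ (j * (j + 1))) :
    ‖∫ θ in (0 : ℝ)..(2 * Real.pi),
        Complex.I * Complex.exp (θ * Complex.I) *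
          regQuot p v (τ ^ j) (Complex.exp (θ * Complex.I))‖ ≤
      16 * Real.pi ^ 2 * (N + 1) * τ := by
  have hr : 0 < τ ^ j := by positivity
  rw [circle_integral_regQuot p v hr]
  have hpi := Real.pi_pos
  have hinner : ∀ θ : ℝ, ‖∫ s in (0 : ℝ)..1,
      2 * Complex.I * s * (v.eval (s * Complex.exp (θ * Complex.I)) *
          (starRingEnd ℂ) (p.derivative.eval (s * Complex.exp (θ * Complex.I))) *
            ((τ ^ j : ℝ) : ℂ) ^ 2 /
          (((‖p.eval (s * Complex.exp (θ * Complex.I))‖ ^ 2 + (τ ^ j) ^ 2 : ℝ) : ℂ)) ^ 2)‖ ≤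
      8 * Real.pi * (N + 1) * τ := by
    intro θ
    set e := Complex.exp (θ * Complex.I) with he
    have he1 : ‖e‖ = 1 := Complex.norm_exp_ofReal_mul_I θ
    have hcW : Continuous fun s : ℝ => (s : ℂ) * e :=
      Complex.continuous_ofReal.mul continuous_const
    have hcont : Continuous fun s : ℝ => 4 * τ * (‖p.derivative.eval ((s : ℂ) * e)‖ *
        (τ ^ j / (‖p.eval ((s : ℂ) * e)‖ ^ 2 + (τ ^ j) ^ 2))) := by
      refine continuous_const.mul ((p.derivative.continuous.comp hcW).norm.mul
        (continuous_const.div ?_ fun s => by positivity))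
      exact ((p.continuous.comp hcW).norm.pow 2).add continuous_const
    refine (intervalIntegral.norm_integral_le_of_norm_le zero_le_one (MeasureTheory.ae_of_all _
      fun s hs => ?_) (hcont.intervalIntegrable 0 1)).trans ?_
    · have hw : ‖(s : ℂ) * e‖ ≤ 1 := by
        rw [norm_mul, he1, mul_one, Complex.norm_real, Real.norm_eq_abs, abs_of_pos hs.1]
        exact hs.2
      have hm := mul_div_sq_le_of_pow_le (norm_nonneg _) (norm_nonneg _) hτ hj (h _ hw)
      set a := v.eval ((s : ℂ) * e)
      set b := p.eval ((s : ℂ) * e)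
      set b' := p.derivative.eval ((s : ℂ) * e)
      have hX : 0 < ‖b‖ ^ 2 + (τ ^ j) ^ 2 := by positivity
      have : ‖2 * Complex.I * s * (a * (starRingEnd ℂ) b' * ((τ ^ j : ℝ) : ℂ) ^ 2 /
          (((‖b‖ ^ 2 + (τ ^ j) ^ 2 : ℝ) : ℂ)) ^ 2)‖ =
          2 * s * ‖b'‖ * (‖a‖ * (τ ^ j) ^ 2 / (‖b‖ ^ 2 + (τ ^ j) ^ 2) ^ 2) := by
        simp only [norm_mul, norm_div, norm_pow, Complex.norm_I, Complex.norm_real,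
          RCLike.norm_conj, Real.norm_eq_abs, abs_of_pos hs.1, abs_of_pos hX, abs_of_pos hτ,
          Complex.norm_ofNat]
        ring
      rw [this]
      have h0 : 0 ≤ ‖a‖ * (τ ^ j) ^ 2 / (‖b‖ ^ 2 + (τ ^ j) ^ 2) ^ 2 := by positivity
      calc 2 * s * ‖b'‖ * (‖a‖ * (τ ^ j) ^ 2 / (‖b‖ ^ 2 + (τ ^ j) ^ 2) ^ 2)
          ≤ 2 * 1 * ‖b'‖ * (‖a‖ * (τ ^ j) ^ 2 / (‖b‖ ^ 2 + (τ ^ j) ^ 2) ^ 2) := by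
            gcongr; exact hs.2
        _ ≤ 2 * 1 * ‖b'‖ * (2 * τ * (τ ^ j / (‖b‖ ^ 2 + (τ ^ j) ^ 2))) := by gcongr
        _ = _ := by ring
    · rw [intervalIntegral.integral_const_mul]
      have := integral_norm_derivative_mul_le p hN hr he1
      calc _ ≤ 4 * τ * (2 * (N + 1) * Real.pi) := by gcongr
        _ = _ := by ring
  refine (intervalIntegral.norm_integral_le_of_norm_le_const fun θ _ => hinner θ).trans ?_
  rw [sub_zero, abs_of_pos (by positivity)]
  apply le_of_eq; ring

lemma norm_pow_sub_pow_le {a b : ℂ} {R : ℝ} (hR : 1 ≤ R) (ha : ‖a‖ ≤ R) (hb : ‖b‖ ≤ R) (k : ℕ) :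
    ‖a ^ k - b ^ k‖ ≤ k * R ^ k * ‖a - b‖ := by
  induction k with
  | zero => simp
  | succ k ih =>
    have h1 : a ^ (k + 1) - b ^ (k + 1) = a ^ k * (a - b) + (a ^ k - b ^ k) * b := by ring
    have h2 : ‖a‖ ^ k ≤ R ^ k := pow_le_pow_left₀ (norm_nonneg _) ha k
    have hRk : 0 ≤ R ^ k := by positivity
    have h3 : R ^ k ≤ R ^ (k + 1) := pow_le_pow_right₀ hR (Nat.le_succ k)
    have hn := norm_nonneg (a - b)
    calc ‖a ^ (k + 1) - b ^ (k + 1)‖ ≤ ‖a‖ ^ k * ‖a - b‖ + ‖a ^ k - b ^ k‖ * ‖b‖ := by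
          rw [h1]; refine (norm_add_le _ _).trans ?_
          rw [norm_mul, norm_mul, norm_pow]
      _ ≤ R ^ (k + 1) * ‖a - b‖ + (k * R ^ k * ‖a - b‖) * R := by
          gcongr
          exact h2.trans h3
      _ = _ := by push_cast; ring

lemma norm_eval_le_of_circle (E : Polynomial ℂ) {B : ℝ}
    (h : ∀ θ : ℝ, ‖E.eval (Complex.exp (θ * Complex.I))‖ ≤ B) {w : ℂ} (hw : ‖w‖ ≤ 1) :
    ‖E.eval w‖ ≤ B := by
  refine Complex.norm_le_of_forall_mem_frontier_norm_le (U := Metric.ball (0 : ℂ) 1)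
    Metric.isBounded_ball E.differentiable.diffContOnCl ?_ ?_
  · intro z hz
    rw [frontier_ball _ one_ne_zero, mem_sphere_zero_iff_norm] at hz
    have : z = Complex.exp (z.arg * Complex.I) := by
      conv_lhs => rw [← Complex.norm_mul_exp_arg_mul_I z, hz]
      simp
    rw [this]
    exact h _
  · rw [closure_ball _ one_ne_zero]
    simpa using hw

/-- If `F ^ j` and `F ^ (j + 1)` are, on the circle, `δ`-close to trigonometric polynomials of
degree `n`, then the Fourier coefficient of order `n + 1` of `F` is small. -/
lemma exists_norm_integral_le_of_approx {j : ℕ} (hj : 1 ≤ j) {K : ℝ} (hK : 0 ≤ K) :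
    ∃ C : ℝ, 1 ≤ C ∧ ∀ (n : ℕ) (τ δ : ℝ) (F : ℝ → ℂ) (p q : Polynomial ℂ),
      0 < τ → τ ≤ 1 → C * δ ≤ τ ^ (j * (j + 1)) → Continuous F → (∀ θ, ‖F θ‖ ≤ K) →
      p.natDegree ≤ 2 * n →
      (∀ θ : ℝ, ‖p.eval (Complex.exp (θ * Complex.I)) -
        Complex.exp (θ * Complex.I) ^ n * F θ ^ j‖ ≤ δ) →
      (∀ θ : ℝ, ‖q.eval (Complex.exp (θ * Complex.I)) -
        Complex.exp (θ * Complex.I) ^ n * F θ ^ (j + 1)‖ ≤ δ) →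
      ‖∫ θ in (0 : ℝ)..(2 * Real.pi), Complex.exp (θ * Complex.I) ^ (n + 1) * F θ‖ ≤
        C * (n + 1) * τ := by
  set R : ℝ := (K + 1) ^ (j + 1) + 1 with hR
  have hR1 : 1 ≤ R := by rw [hR]; have : 0 ≤ (K + 1) ^ (j + 1) := by positivity
                         linarith
  refine ⟨(2 * j + 1) * R ^ (j + 1) + 32 * Real.pi ^ 2 + 2 * Real.pi * (K + 3), ?_, ?_⟩
  · have h1 : 1 ≤ R ^ (j + 1) := one_le_pow₀ hR1
    have h2 : (0 : ℝ) ≤ j := Nat.cast_nonneg j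
    have h3 := Real.pi_pos
    have h4 : 0 ≤ 2 * Real.pi * (K + 3) := by positivity
    nlinarith [sq_nonneg Real.pi]
  intro n τ δ F p q hτ hτ1 hδτ hF hFK hp hpF hqF
  have hδ0 : 0 ≤ δ := (norm_nonneg _).trans (hpF 0)
  have hpi := Real.pi_pos
  have hRj : 1 ≤ R ^ (j + 1) := one_le_pow₀ hR1
  have hj0 : (0 : ℝ) ≤ j := Nat.cast_nonneg j
  have hδE : (2 * j + 1) * R ^ (j + 1) * δ ≤ τ ^ (j * (j + 1)) := by
    refine le_trans (mul_le_mul_of_nonneg_right ?_ hδ0) hδτ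
    have : 0 ≤ 2 * Real.pi * (K + 3) := by positivity
    nlinarith [sq_nonneg Real.pi]
  have hδτ' : δ ≤ τ ^ (j * (j + 1)) := by
    refine le_trans ?_ hδE
    have : 1 ≤ (2 * j + 1) * R ^ (j + 1) := by nlinarith
    nlinarith
  have hδ1 : δ ≤ 1 := hδτ'.trans (pow_le_one₀ hτ.le hτ1)
  have hr : 0 < τ ^ j := by positivity
  have hw1 : ∀ θ : ℝ, ‖Complex.exp (θ * Complex.I)‖ = 1 := Complex.norm_exp_ofReal_mul_I
  have hFpow : ∀ θ : ℝ, ∀ i ≤ j + 1, ‖Complex.exp (θ * Complex.I) ^ n * F θ ^ i‖ ≤ R - 1 := by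
    intro θ i hi
    rw [norm_mul, norm_pow, norm_pow, hw1, one_pow, one_mul, hR, add_sub_cancel_right]
    calc ‖F θ‖ ^ i ≤ (K + 1) ^ i := pow_le_pow_left₀ (norm_nonneg _) (by linarith [hFK θ]) _
      _ ≤ _ := pow_le_pow_right₀ (by linarith) hi
  have hpR : ∀ θ : ℝ, ‖p.eval (Complex.exp (θ * Complex.I))‖ ≤ R := by
    intro θ
    have h1 := hFpow θ j (Nat.le_succ j)
    have h2 := norm_le_norm_add_norm_sub' (p.eval (Complex.exp (θ * Complex.I)))
      (Complex.exp (θ * Complex.I) ^ n * F θ ^ j)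
    linarith [hpF θ]
  have hqR : ∀ θ : ℝ, ‖q.eval (Complex.exp (θ * Complex.I))‖ ≤ R := by
    intro θ
    have h1 := hFpow θ (j + 1) le_rfl
    have h2 := norm_le_norm_add_norm_sub' (q.eval (Complex.exp (θ * Complex.I)))
      (Complex.exp (θ * Complex.I) ^ n * F θ ^ (j + 1))
    linarith [hqF θ]
  set E : Polynomial ℂ := Polynomial.X ^ n * q ^ j - p ^ (j + 1) with hE
  have hEc : ∀ θ : ℝ, ‖E.eval (Complex.exp (θ * Complex.I))‖ ≤ τ ^ (j * (j + 1)) := by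
    intro θ
    have h1 := norm_pow_sub_pow_le hR1 (hqR θ) ((hFpow θ (j + 1) le_rfl).trans (by linarith)) j
    have h2 := norm_pow_sub_pow_le hR1 (hpR θ)
      ((hFpow θ j (Nat.le_succ j)).trans (by linarith)) (j + 1)
    have hq' := hqF θ
    have hp' := hpF θ
    simp only [hE, Polynomial.eval_sub, Polynomial.eval_mul, Polynomial.eval_pow,
      Polynomial.eval_X]
    set w := Complex.exp (θ * Complex.I) with hw
    have hid : w ^ n * q.eval w ^ j - p.eval w ^ (j + 1) =
        w ^ n * (q.eval w ^ j - (w ^ n * F θ ^ (j + 1)) ^ j) -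
          (p.eval w ^ (j + 1) - (w ^ n * F θ ^ j) ^ (j + 1)) := by ring
    have hwn : ‖w ^ n‖ = 1 := by rw [norm_pow, hw1, one_pow]
    have hRjj : R ^ j ≤ R ^ (j + 1) := pow_le_pow_right₀ hR1 (Nat.le_succ j)
    calc _ ≤ ‖q.eval w ^ j - (w ^ n * F θ ^ (j + 1)) ^ j‖ +
          ‖p.eval w ^ (j + 1) - (w ^ n * F θ ^ j) ^ (j + 1)‖ := by
          rw [hid]; refine (norm_sub_le _ _).trans ?_
          rw [norm_mul, hwn, one_mul]
      _ ≤ j * R ^ j * δ + ((j + 1 : ℕ) : ℝ) * R ^ (j + 1) * δ :=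
          add_le_add (h1.trans (by gcongr)) (h2.trans (by gcongr))
      _ ≤ j * R ^ (j + 1) * δ + ((j + 1 : ℕ) : ℝ) * R ^ (j + 1) * δ := by gcongr
      _ = (2 * j + 1) * R ^ (j + 1) * δ := by push_cast; ring
      _ ≤ _ := hδE
  have hmain := norm_circle_integral_regQuot_le p (Polynomial.X ^ n * q) hp hj hτ (by
    intro w hw
    have h1 := norm_eval_le_of_circle E hEc hw
    simp only [hE, Polynomial.eval_sub, Polynomial.eval_mul, Polynomial.eval_pow,
      Polynomial.eval_X] at h1 ⊢
    have h2 := norm_le_norm_add_norm_sub' (w ^ n * q.eval w ^ j) (p.eval w ^ (j + 1))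
    have h3 : ‖w ^ n * q.eval w‖ ^ j ≤ ‖w ^ n * q.eval w ^ j‖ := by
      rw [norm_mul, norm_mul, mul_pow, norm_pow (q.eval w)]
      refine mul_le_mul_of_nonneg_right ?_ (by positivity)
      rw [norm_pow]
      exact pow_le_of_le_one (by positivity) (pow_le_one₀ (norm_nonneg _) hw) (by lia)
    rw [norm_pow (p.eval w)] at h2
    linarith)
  set G : ℝ → ℂ := fun θ => Complex.I * Complex.exp (θ * Complex.I) *
    regQuot p (Polynomial.X ^ n * q) (τ ^ j) (Complex.exp (θ * Complex.I)) with hG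
  have hexp : Continuous fun θ : ℝ => Complex.exp (θ * Complex.I) := by fun_prop
  have hGc : Continuous G :=
    (continuous_const.mul hexp).mul ((differentiable_regQuot _ _ hr).continuous.comp hexp)
  have hdiff : ∀ θ : ℝ,
      ‖Complex.I * (Complex.exp (θ * Complex.I) ^ (n + 1) * F θ) - G θ‖ ≤ (K + 3) * τ := by
    intro θ
    have hq' := hqF θ
    have hp' := hpF θ
    have hw1' := hw1 θ
    simp only [hG, regQuot, Polynomial.eval_mul, Polynomial.eval_pow, Polynomial.eval_X]
    set w := Complex.exp (θ * Complex.I) with hw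
    set a := q.eval w
    set b := p.eval w
    have hwn : ‖w ^ n‖ = 1 := by rw [norm_pow, hw1', one_pow]
    have hne := regQuot_denom_ne b hr
    have hid : Complex.I * (w ^ (n + 1) * F θ) - Complex.I * w *
        (w ^ n * a * (starRingEnd ℂ) b / (b * (starRingEnd ℂ) b + ((τ ^ j : ℝ) : ℂ) ^ 2)) =
        Complex.I * w * w ^ n * (((F θ * b - a) * (starRingEnd ℂ) b + F θ * ((τ ^ j : ℝ) : ℂ) ^ 2) /
          (b * (starRingEnd ℂ) b + ((τ ^ j : ℝ) : ℂ) ^ 2)) := by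
      have hgen : ∀ c T : ℂ, b * c + T ≠ 0 → Complex.I * (w ^ (n + 1) * F θ) -
          Complex.I * w * (w ^ n * a * c / (b * c + T)) =
          Complex.I * w * w ^ n * (((F θ * b - a) * c + F θ * T) / (b * c + T)) := by
        intro c T h
        rw [mul_div_assoc', mul_div_assoc', eq_div_iff h, sub_mul, div_mul_cancel₀ _ h]
        ring
      exact hgen _ _ hne
    have hX : 0 < ‖b‖ ^ 2 + (τ ^ j) ^ 2 := by positivity
    rw [hid, norm_mul, norm_mul, norm_mul, hwn, hw1', Complex.norm_I, one_mul, one_mul, one_mul,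
      regQuot_denom_eq, norm_div, Complex.norm_real, Real.norm_eq_abs, abs_of_pos hX]
    have h1 : ‖F θ * b - a‖ ≤ (K + 1) * δ := by
      have : F θ * b - a = F θ * (b - w ^ n * F θ ^ j) - (a - w ^ n * F θ ^ (j + 1)) := by ring
      rw [this]
      refine (norm_sub_le _ _).trans ?_
      rw [norm_mul]
      have := mul_le_mul (hFK θ) hp' (norm_nonneg _) hK
      linarith
    have h2 : ‖F θ‖ * (τ ^ j) ^ 2 / (‖b‖ ^ 2 + (τ ^ j) ^ 2) ≤ 2 * τ := by
      refine mul_div_le_of_pow_le (norm_nonneg _) hτ hj ?_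
      have e1 : ‖F θ‖ ^ j = ‖w ^ n * F θ ^ j‖ := by rw [norm_mul, hwn, one_mul, norm_pow]
      have e2 := norm_le_norm_add_norm_sub b (w ^ n * F θ ^ j)
      have e3 : τ ^ (j * (j + 1)) ≤ τ ^ j :=
        pow_le_pow_of_le_one hτ.le hτ1 (Nat.le_mul_of_pos_right _ (Nat.succ_pos _))
      rw [e1]
      linarith [norm_sub_rev b (w ^ n * F θ ^ j)]
    have h3 : (K + 1) * δ * ‖b‖ / (‖b‖ ^ 2 + (τ ^ j) ^ 2) ≤ (K + 1) * τ := by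
      rw [div_le_iff₀ hX]
      have e1 : δ ≤ τ * τ ^ j := by
        refine hδτ'.trans ?_
        rw [← pow_succ']
        exact pow_le_pow_of_le_one hτ.le hτ1 (Nat.le_mul_of_pos_left _ (by lia))
      have e2 : τ ^ j * ‖b‖ ≤ ‖b‖ ^ 2 + (τ ^ j) ^ 2 := by
        nlinarith [sq_nonneg (‖b‖ - τ ^ j), mul_nonneg hr.le (norm_nonneg b)]
      calc (K + 1) * δ * ‖b‖ ≤ (K + 1) * (τ * τ ^ j) * ‖b‖ := by gcongr
        _ = (K + 1) * τ * (τ ^ j * ‖b‖) := by ring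
        _ ≤ _ := by gcongr
    calc ‖(F θ * b - a) * (starRingEnd ℂ) b + F θ * ((τ ^ j : ℝ) : ℂ) ^ 2‖ /
          (‖b‖ ^ 2 + (τ ^ j) ^ 2)
        ≤ ((K + 1) * δ * ‖b‖ + ‖F θ‖ * (τ ^ j) ^ 2) / (‖b‖ ^ 2 + (τ ^ j) ^ 2) := by
          gcongr
          refine (norm_add_le _ _).trans ?_
          rw [norm_mul, norm_mul, RCLike.norm_conj, norm_pow, Complex.norm_real,
            Real.norm_eq_abs, abs_of_pos hr]
          gcongr
      _ = (K + 1) * δ * ‖b‖ / (‖b‖ ^ 2 + (τ ^ j) ^ 2) +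
          ‖F θ‖ * (τ ^ j) ^ 2 / (‖b‖ ^ 2 + (τ ^ j) ^ 2) := add_div _ _ _
      _ ≤ _ := by linarith
  have hFc : Continuous fun θ : ℝ => Complex.I * (Complex.exp (θ * Complex.I) ^ (n + 1) * F θ) :=
    continuous_const.mul ((hexp.pow _).mul hF)
  have hsub : ‖(∫ θ in (0 : ℝ)..(2 * Real.pi),
      Complex.I * (Complex.exp (θ * Complex.I) ^ (n + 1) * F θ)) -
      ∫ θ in (0 : ℝ)..(2 * Real.pi), G θ‖ ≤ (K + 3) * τ * (2 * Real.pi) := by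
    rw [← intervalIntegral.integral_sub (hFc.intervalIntegrable _ _) (hGc.intervalIntegrable _ _)]
    refine (intervalIntegral.norm_integral_le_of_norm_le_const fun θ _ => hdiff θ).trans ?_
    rw [sub_zero, abs_of_pos (by positivity)]
  rw [intervalIntegral.integral_const_mul] at hsub
  have hfin := norm_le_norm_add_norm_sub' (Complex.I * ∫ θ in (0 : ℝ)..(2 * Real.pi),
      Complex.exp (θ * Complex.I) ^ (n + 1) * F θ) (∫ θ in (0 : ℝ)..(2 * Real.pi), G θ)
  rw [norm_mul, Complex.norm_I, one_mul] at hfin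
  have hn0 : (0 : ℝ) ≤ n := Nat.cast_nonneg n
  have hA : 0 ≤ (2 * j + 1) * R ^ (j + 1) := by positivity
  have hmain' : ‖∫ θ in (0 : ℝ)..(2 * Real.pi), G θ‖ ≤ 32 * Real.pi ^ 2 * (n + 1) * τ := by
    refine hmain.trans ?_
    push_cast
    have : 0 ≤ Real.pi ^ 2 * τ := by positivity
    nlinarith
  have hB : (K + 3) * τ * (2 * Real.pi) ≤ 2 * Real.pi * (K + 3) * (n + 1) * τ := by
    have : 0 ≤ 2 * Real.pi * (K + 3) * τ := by positivity
    nlinarith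
  have hAA : 0 ≤ (2 * j + 1) * R ^ (j + 1) * (n + 1) * τ := by positivity
  calc _ ≤ 32 * Real.pi ^ 2 * (n + 1) * τ + 2 * Real.pi * (K + 3) * (n + 1) * τ := by linarith
    _ ≤ _ := by linarith

namespace IsWeightFunction

variable {ω : ℝ → ℝ}

lemma exists_mul_log_le (hω : IsWeightFunction ω) {A : ℝ} (hA : 0 < A) :
    ∃ B : ℝ, 0 ≤ B ∧ ∀ t, 0 ≤ t → A * Real.log (1 + t) ≤ ω t + B := by
  have h1 := hω.logLittleO.def (inv_pos.2 hA)
  obtain ⟨t₀, ht₀⟩ := (h1.and (eventually_ge_atTop 1)).exists_forall_of_atTop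
  have ht1 : 1 ≤ t₀ := (ht₀ t₀ le_rfl).2
  have hl2 : 0 ≤ Real.log 2 := Real.log_nonneg one_le_two
  have hl0 : 0 ≤ Real.log (1 + t₀) := Real.log_nonneg (by linarith)
  refine ⟨A * Real.log 2 + A * Real.log (1 + t₀), by positivity, fun t ht => ?_⟩
  rcases le_total t₀ t with h | h
  · obtain ⟨h2, h3⟩ := ht₀ t h
    rw [Real.norm_of_nonneg (Real.log_nonneg h3), Real.norm_of_nonneg (hω.nonneg t ht)] at h2
    have h4 : Real.log (1 + t) ≤ Real.log 2 + Real.log t := by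
      rw [← Real.log_mul two_ne_zero (by linarith)]
      exact Real.log_le_log (by linarith) (by linarith)
    have h5 : A * Real.log t ≤ ω t := by
      calc A * Real.log t ≤ A * (A⁻¹ * ω t) := by gcongr
        _ = ω t := by field_simp
    nlinarith [mul_le_mul_of_nonneg_left h4 hA.le, mul_nonneg hA.le hl0]
  · have h4 : Real.log (1 + t) ≤ Real.log (1 + t₀) := Real.log_le_log (by linarith) (by linarith)
    nlinarith [mul_le_mul_of_nonneg_left h4 hA.le, mul_nonneg hA.le hl2, hω.nonneg t ht]

lemma exists_two_mul_le (hω : IsWeightFunction ω) :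
    ∃ D : ℝ, 1 ≤ D ∧ ∃ B : ℝ, 0 ≤ B ∧ ∀ t, 0 ≤ t → ω (2 * t) ≤ D * ω t + B := by
  obtain ⟨D, hD⟩ := hω.bigO.bound
  obtain ⟨t₀, ht₀⟩ := (hD.and (eventually_ge_atTop 0)).exists_forall_of_atTop
  have h0 : 0 ≤ t₀ := (ht₀ t₀ le_rfl).2
  refine ⟨max D 1, le_max_right _ _, ω (2 * t₀), hω.nonneg _ (by linarith), fun t ht => ?_⟩
  have hD1 : 0 ≤ max D 1 := zero_le_one.trans (le_max_right _ _)
  rcases le_total t₀ t with h | h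
  · have h2 := (ht₀ t h).1
    rw [Real.norm_of_nonneg (hω.nonneg _ (by linarith)), Real.norm_of_nonneg (hω.nonneg t ht)] at h2
    have := mul_le_mul_of_nonneg_right (le_max_left D 1) (hω.nonneg t ht)
    linarith [hω.nonneg (2 * t₀) (by linarith)]
  · have := hω.mono (a := 2 * t) (b := 2 * t₀) (mem_Ici.2 (by linarith))
      (mem_Ici.2 (by linarith)) (by linarith)
    nlinarith [mul_nonneg hD1 (hω.nonneg t ht)]

lemma exists_mul_le (hω : IsWeightFunction ω) (a : ℝ) :
    ∃ D : ℝ, 1 ≤ D ∧ ∃ B : ℝ, 0 ≤ B ∧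
      ∀ s t, 0 ≤ s → 0 ≤ t → s ≤ a * t → ω s ≤ D * ω t + B := by
  have key : ∀ n : ℕ, ∃ D : ℝ, 1 ≤ D ∧ ∃ B : ℝ, 0 ≤ B ∧
      ∀ t, 0 ≤ t → ω (2 ^ n * t) ≤ D * ω t + B := by
    obtain ⟨D, hD, B, hB, h⟩ := hω.exists_two_mul_le
    intro n
    induction n with
    | zero => exact ⟨1, le_rfl, 0, le_rfl, fun t _ => by simp⟩
    | succ n ih =>
      obtain ⟨D', hD', B', hB', h'⟩ := ih
      refine ⟨D * D', by nlinarith, D * B' + B, by positivity, fun t ht => ?_⟩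
      have h1 := h (2 ^ n * t) (by positivity)
      have h2 := mul_le_mul_of_nonneg_left (h' t ht) (zero_le_one.trans hD)
      rw [pow_succ', mul_assoc]
      linarith
  obtain ⟨n, hn⟩ := pow_unbounded_of_one_lt a one_lt_two
  obtain ⟨D, hD, B, hB, h⟩ := key n
  refine ⟨D, hD, B, hB, fun s t hs ht hst => (hω.mono hs ?_ ?_).trans (h t ht)⟩
  · exact mem_Ici.2 (by positivity)
  · exact hst.trans (mul_le_mul_of_nonneg_right hn.le ht)

lemma exists_le_mul_add (hω : IsWeightFunction ω) {η : ℝ} (hη : 0 < η) :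
    ∃ B : ℝ, 0 ≤ B ∧ ∀ t, 0 ≤ t → ω t ≤ η * t + B := by
  obtain ⟨t₀, ht₀⟩ := ((hω.littleO.def hη).and (eventually_ge_atTop 0)).exists_forall_of_atTop
  have h0 : 0 ≤ t₀ := (ht₀ t₀ le_rfl).2
  refine ⟨ω t₀, hω.nonneg _ h0, fun t ht => ?_⟩
  rcases le_total t₀ t with h | h
  · have h2 := (ht₀ t h).1
    rw [Real.norm_of_nonneg (hω.nonneg _ ht), Real.norm_of_nonneg ht] at h2
    linarith [hω.nonneg _ h0]
  · have := hω.mono ht h0 h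
    nlinarith

lemma bddAbove_youngConj (hω : IsWeightFunction ω) (s : ℝ) :
    BddAbove {y : ℝ | ∃ t : ℝ, 0 ≤ t ∧ y = s * t - ω (Real.exp t)} := by
  obtain ⟨B, -, hB⟩ := hω.exists_mul_log_le (A := |s| + 1) (by positivity)
  refine ⟨B, ?_⟩
  rintro y ⟨t, ht, rfl⟩
  have h1 := hB (Real.exp t) (Real.exp_pos t).le
  have h2 : t ≤ Real.log (1 + Real.exp t) := by
    conv_lhs => rw [← Real.log_exp t]
    exact Real.log_le_log (Real.exp_pos t) (by linarith)
  have h3 : s * t ≤ (|s| + 1) * t := mul_le_mul_of_nonneg_right (by linarith [le_abs_self s]) ht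
  have h4 := mul_le_mul_of_nonneg_left h2 (by positivity : 0 ≤ |s| + 1)
  linarith

end IsWeightFunction

/-- The bound `exp (φ*_ω (ρ k) / ρ)` on derivatives of order `k`. -/
def bmt (ω : ℝ → ℝ) (ρ : ℝ) (k : ℕ) : ℝ := Real.exp ((1 / ρ) * youngConj ω (ρ * k))

lemma bmt_pos (ω : ℝ → ℝ) (ρ : ℝ) (k : ℕ) : 0 < bmt ω ρ k := Real.exp_pos _

namespace IsWeightFunction

variable {ω : ℝ → ℝ}

lemma exp_le_bmt (hω : IsWeightFunction ω) {ρ : ℝ} (hρ : 0 < ρ) (k : ℕ) {t : ℝ} (ht : 0 ≤ t) :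
    Real.exp (k * t - ω (Real.exp t) / ρ) ≤ bmt ω ρ k := by
  refine Real.exp_le_exp.2 ?_
  have h := le_csSup (hω.bddAbove_youngConj (ρ * k)) ⟨t, ht, rfl⟩
  calc k * t - ω (Real.exp t) / ρ = (1 / ρ) * (ρ * k * t - ω (Real.exp t)) := by field_simp
    _ ≤ _ := mul_le_mul_of_nonneg_left h (by positivity)

lemma pow_le_bmt_mul (hω : IsWeightFunction ω) {ρ : ℝ} (hρ : 0 < ρ) (k : ℕ) {M : ℝ} (hM : 1 ≤ M) :
    M ^ k ≤ bmt ω ρ k * Real.exp (ω M / ρ) := by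
  have h := hω.exp_le_bmt hρ k (Real.log_nonneg hM)
  have hM0 : 0 < M := by linarith
  rw [Real.exp_log hM0, Real.exp_sub, mul_comm, ← Real.rpow_def_of_pos hM0, Real.rpow_natCast,
    div_le_iff₀ (Real.exp_pos _)] at h
  exact h

lemma bmt_le {ρ : ℝ} (hρ : 0 < ρ) (k : ℕ) {B : ℝ}
    (h : ∀ t, 0 ≤ t → Real.exp (k * t - ω (Real.exp t) / ρ) ≤ B) : bmt ω ρ k ≤ B := by
  have hB : 0 < B := (Real.exp_pos _).trans_le (h 0 le_rfl)
  rw [bmt, ← Real.le_log_iff_exp_le hB, one_div, inv_mul_le_iff₀ hρ]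
  refine csSup_le ⟨_, 0, le_rfl, rfl⟩ ?_
  rintro y ⟨t, ht, rfl⟩
  have h1 := (Real.le_log_iff_exp_le hB).2 (h t ht)
  have h2 := mul_le_mul_of_nonneg_left h1 hρ.le
  have h3 : ρ * (k * t - ω (Real.exp t) / ρ) = ρ * k * t - ω (Real.exp t) := by field_simp
  linarith

lemma bmt_mono (hω : IsWeightFunction ω) {ρ ρ' : ℝ} (hρ : 0 < ρ) (h : ρ ≤ ρ') (k : ℕ) :
    bmt ω ρ k ≤ bmt ω ρ' k := by
  refine bmt_le hρ k fun t ht => (Real.exp_le_exp.2 ?_).trans (hω.exp_le_bmt (hρ.trans_le h) k ht)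
  have := hω.nonneg _ (Real.exp_pos t).le
  gcongr

lemma exists_pow_mul_bmt_le (hω : IsWeightFunction ω) {ρ A : ℝ} (hρ : 0 < ρ) (hA : 1 ≤ A) :
    ∃ ρ', ρ ≤ ρ' ∧ ∃ C : ℝ, 0 < C ∧ ∀ k, A ^ k * bmt ω ρ k ≤ C * bmt ω ρ' k := by
  obtain ⟨D, hD, B, hB, h⟩ := hω.exists_mul_le A
  have hD0 : 0 < D := by linarith
  have hA0 : 0 < A := by linarith
  refine ⟨D * ρ, by nlinarith, Real.exp (B / (D * ρ)), Real.exp_pos _, fun k => ?_⟩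
  have hAk : 0 < A ^ k := by positivity
  rw [← le_div_iff₀' hAk]
  refine bmt_le hρ k fun t ht => ?_
  rw [le_div_iff₀' hAk]
  have h1 := hω.exp_le_bmt (ρ := D * ρ) (by positivity) k (t := t + Real.log A)
    (add_nonneg ht (Real.log_nonneg hA))
  refine le_trans ?_ (mul_le_mul_of_nonneg_left h1 (Real.exp_pos _).le)
  have h2 : A ^ k = Real.exp (k * Real.log A) := by
    rw [mul_comm, ← Real.rpow_def_of_pos hA0, Real.rpow_natCast]
  rw [h2, ← Real.exp_add, ← Real.exp_add, Real.exp_le_exp]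
  have h3 := h (Real.exp (t + Real.log A)) (Real.exp t) (Real.exp_pos _).le (Real.exp_pos _).le
    (by rw [Real.exp_add, Real.exp_log hA0, mul_comm])
  have h4 : ω (Real.exp (t + Real.log A)) / (D * ρ) ≤ ω (Real.exp t) / ρ + B / (D * ρ) := by
    calc _ ≤ (D * ω (Real.exp t) + B) / (D * ρ) := by gcongr
      _ = _ := by field_simp
  linarith

lemma exists_factorial_le (hω : IsWeightFunction ω) :
    ∃ ρ, 0 < ρ ∧ ∃ C : ℝ, 0 < C ∧ ∀ k : ℕ, (k.factorial : ℝ) ≤ C * bmt ω ρ k := by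
  obtain ⟨B, hB, h⟩ := hω.exists_le_mul_add one_pos
  obtain ⟨ρ', hρ', C, hC, h'⟩ := hω.exists_pow_mul_bmt_le one_pos
    (A := Real.exp 1) (Real.one_le_exp zero_le_one)
  refine ⟨ρ', by linarith, Real.exp (1 + B) * C, by positivity, fun k => ?_⟩
  have h1 : (k.factorial : ℝ) ≤ ((k : ℝ) + 1) ^ k := by
    calc (k.factorial : ℝ) ≤ (k : ℝ) ^ k := by exact_mod_cast Nat.factorial_le_pow k
      _ ≤ _ := pow_le_pow_left₀ (by positivity) (by linarith) _
  have h2 := hω.pow_le_bmt_mul one_pos k (M := (k : ℝ) + 1) (by linarith [k.cast_nonneg (α := ℝ)])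
  have h3 := h ((k : ℝ) + 1) (by positivity)
  have h4 : Real.exp (ω ((k : ℝ) + 1) / 1) ≤ Real.exp (1 + B) * Real.exp 1 ^ k := by
    rw [← Real.exp_nat_mul, ← Real.exp_add, Real.exp_le_exp]
    linarith
  calc (k.factorial : ℝ) ≤ bmt ω 1 k * (Real.exp (1 + B) * Real.exp 1 ^ k) :=
        h1.trans (h2.trans (mul_le_mul_of_nonneg_left h4 (bmt_pos _ _ _).le))
    _ = Real.exp (1 + B) * (Real.exp 1 ^ k * bmt ω 1 k) := by ring
    _ ≤ Real.exp (1 + B) * (C * bmt ω ρ' k) :=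
        mul_le_mul_of_nonneg_left (h' k) (Real.exp_pos _).le
    _ = _ := by ring

end IsWeightFunction

lemma summable_prod_pi {d : ℕ} {a : ℤ → ℝ} (ha : ∀ m, 0 ≤ a m) (hs : Summable a) :
    Summable fun m : Fin d → ℤ => ∏ i, a (m i) := by
  classical
  refine summable_of_sum_le (c := (∑' m, a m) ^ d) (fun m => Finset.prod_nonneg fun i _ => ha _)
    fun s => ?_
  have hsub : s ⊆ Fintype.piFinset fun i : Fin d => s.image fun m => m i := by
    intro m hm
    exact Fintype.mem_piFinset.2 fun i => Finset.mem_image_of_mem _ hm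
  refine (Finset.sum_le_sum_of_subset_of_nonneg hsub fun m _ _ =>
    Finset.prod_nonneg fun i _ => ha _).trans ?_
  rw [← Finset.prod_univ_sum]
  calc ∏ i : Fin d, ∑ m ∈ s.image fun m => m i, a m ≤ ∏ _i : Fin d, ∑' m, a m :=
        Finset.prod_le_prod (fun i _ => Finset.sum_nonneg fun m _ => ha m)
          fun i _ => hs.sum_le_tsum _ fun m _ => ha m
    _ = _ := by simp

lemma IsWeightFunction.summable_exp_neg {ω : ℝ → ℝ} (hω : IsWeightFunction ω) {c : ℝ} (hc : 0 < c)
    (d : ℕ) : Summable fun m : Fin d → ℤ => Real.exp (-c * ω ‖m‖) := by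
  obtain ⟨B, hB, h⟩ := hω.exists_mul_log_le (A := 2 * (d + 1) / c) (by positivity)
  have h1 : Summable fun m : ℤ => ((1 + |(m : ℝ)|) ^ 2)⁻¹ := by
    have := Real.summable_abs_int_rpow (b := 2) one_lt_two
    refine Summable.of_norm_bounded_eventually this ?_
    rw [Filter.eventually_cofinite]
    refine (Set.finite_singleton (0 : ℤ)).subset fun m hm => ?_
    by_contra h0
    apply hm
    have hm0 : 0 < |(m : ℝ)| := abs_pos.2 (by exact_mod_cast h0)
    rw [Real.norm_of_nonneg (by positivity), Real.rpow_neg hm0.le, Real.rpow_two]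
    gcongr
    linarith
  refine Summable.of_nonneg_of_le (fun m => (Real.exp_pos _).le) (fun m => ?_)
    ((summable_prod_pi (d := d) (fun m => by positivity) h1).mul_left (Real.exp (c * B)))
  have h2 := h ‖m‖ (norm_nonneg m)
  have h1n : 0 < 1 + ‖m‖ := by positivity
  have hl : 0 ≤ Real.log (1 + ‖m‖) := Real.log_nonneg (by linarith [norm_nonneg m])
  have h3 : -c * ω ‖m‖ ≤ c * B - (2 * d : ℕ) * Real.log (1 + ‖m‖) := by
    have := mul_le_mul_of_nonneg_left h2 hc.le
    have e : c * (2 * (d + 1) / c * Real.log (1 + ‖m‖)) = 2 * (d + 1) * Real.log (1 + ‖m‖) := by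
      field_simp
    push_cast
    nlinarith
  calc Real.exp (-c * ω ‖m‖) ≤ Real.exp (c * B) * ((1 + ‖m‖) ^ (2 * d))⁻¹ := by
        refine (Real.exp_le_exp.2 h3).trans_eq ?_
        rw [Real.exp_sub, mul_comm ((2 * d : ℕ) : ℝ), ← Real.rpow_def_of_pos h1n,
          Real.rpow_natCast, div_eq_mul_inv]
    _ ≤ _ := by
        gcongr
        rw [pow_mul, ← inv_pow]
        calc (((1 + ‖m‖) ^ 2)⁻¹) ^ d = ∏ _i : Fin d, ((1 + ‖m‖) ^ 2)⁻¹ := by simp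
          _ ≤ _ := Finset.prod_le_prod (fun i _ => by positivity) fun i _ => by
              gcongr
              rw [← Int.norm_eq_abs]
              exact norm_le_pi_norm m i

lemma exists_affine_le_of_convexOn {φ : ℝ → ℝ} (hφ : ConvexOn ℝ (Ici 0) φ) {t₀ : ℝ} (h0 : 0 < t₀) :
    ∃ s : ℝ, ∀ t, 0 ≤ t → φ t₀ + s * (t - t₀) ≤ φ t := by
  have hint : t₀ ∈ interior (Ici (0 : ℝ)) := by rwa [interior_Ici]
  refine ⟨derivWithin φ (Ioi t₀) t₀, fun t ht => ?_⟩
  rcases lt_trichotomy t t₀ with h | h | h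
  · have h1 := hφ.slope_le_leftDeriv_of_mem_interior ht hint h
    have h2 := h1.trans (hφ.leftDeriv_le_rightDeriv_of_mem_interior hint)
    rw [slope_def_field, div_le_iff₀ (by linarith)] at h2
    linarith
  · simp [h]
  · have h1 := hφ.rightDeriv_le_slope_of_mem_interior hint ht h
    rw [slope_def_field, le_div_iff₀ (by linarith)] at h1
    linarith

/-- The optimal order of differentiation for estimating Fourier coefficients at frequency `M`. -/
lemma IsWeightFunction.exists_bmt_le {ω : ℝ → ℝ} (hω : IsWeightFunction ω) {ρ : ℝ} (hρ : 0 < ρ) :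
    ∃ A : ℝ, 0 < A ∧ ∃ c : ℝ, 0 < c ∧ ∀ M : ℝ, 0 ≤ M →
      ∃ k : ℕ, 2 * (k : ℝ) ≤ M ∧ bmt ω ρ k ≤ A * Real.exp (-c * ω M) * (M / 2) ^ k := by
  obtain ⟨D, hD, B, hB, hDB⟩ := hω.exists_mul_le 2
  obtain ⟨B₁, hB₁, h₁⟩ := hω.exists_mul_log_le (A := 2 * ρ) (by positivity)
  obtain ⟨B₂, hB₂, h₂⟩ := hω.exists_le_mul_add (η := ρ / 8) (by positivity)
  have hD0 : 0 < D := by linarith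
  set M₀ : ℝ := max 4 (4 * B₂ / ρ) with hM₀
  set c : ℝ := 1 / (2 * ρ * D) with hc
  have hc0 : 0 < c := by positivity
  refine ⟨max (Real.exp (c * ω M₀)) (Real.exp (B₁ / (2 * ρ) + c * B)), by positivity,
    c, hc0, fun M hM => ?_⟩
  rcases le_total M M₀ with hMM | hMM
  · refine ⟨0, by simpa using hM, ?_⟩
    have h1 : bmt ω ρ 0 ≤ 1 := IsWeightFunction.bmt_le hρ 0 fun t _ => by
      rw [Real.exp_le_one_iff]
      have := hω.nonneg _ (Real.exp_pos t).le
      have : 0 ≤ ω (Real.exp t) / ρ := by positivity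
      push_cast
      linarith
    have h2 : ω M ≤ ω M₀ := hω.mono hM (hM.trans hMM) hMM
    rw [pow_zero, mul_one]
    calc bmt ω ρ 0 ≤ Real.exp (c * ω M₀) * Real.exp (-c * ω M) := by
          refine h1.trans ?_
          rw [← Real.exp_add, Real.one_le_exp_iff]
          nlinarith
      _ ≤ _ := by gcongr; exact le_max_left _ _
  have hM4 : 4 ≤ M := (le_max_left _ _).trans hMM
  have hMB : 4 * B₂ / ρ ≤ M := (le_max_right _ _).trans hMM
  set t₀ := Real.log (M / 2) with ht₀
  have ht0 : 0 < t₀ := Real.log_pos (by linarith)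
  have het : Real.exp t₀ = M / 2 := Real.exp_log (by linarith)
  obtain ⟨s, hs⟩ := exists_affine_le_of_convexOn hω.convex ht0
  have hs' : ∀ t, 0 ≤ t → ω (M / 2) + s * (t - t₀) ≤ ω (Real.exp t) := by
    intro t ht; rw [← het]; exact hs t ht
  have hs0 : 0 ≤ s := by
    have h1 := hs' 0 le_rfl
    have h2 : ω (Real.exp 0) ≤ ω (M / 2) := by
      rw [Real.exp_zero]
      exact hω.mono (mem_Ici.2 zero_le_one) (mem_Ici.2 (by linarith)) (by linarith)
    by_contra hneg
    nlinarith [mul_pos (neg_pos.2 (not_le.1 hneg)) ht0]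
  set k := ⌊s / ρ⌋₊ with hk
  have hk1 : (k : ℝ) ≤ s / ρ := Nat.floor_le (by positivity)
  have hk2 : s / ρ < k + 1 := Nat.lt_floor_add_one _
  refine ⟨k, ?_, ?_⟩
  · have h1 := hs' (t₀ + 1) (by linarith)
    have he : Real.exp (t₀ + 1) ≤ 2 * M := by
      rw [Real.exp_add, het]
      nlinarith [Real.exp_one_lt_d9]
    have h2 := hω.mono (Real.exp_pos (t₀ + 1)).le (mem_Ici.2 (by linarith)) he
    have h3 := h₂ (2 * M) (by linarith)
    have h4 := hω.nonneg (M / 2) (by linarith)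
    have h5 : s ≤ ρ / 8 * (2 * M) + B₂ := by linarith
    rw [div_le_iff₀ hρ] at hMB
    have h6 : s / ρ ≤ M / 2 := by
      rw [div_le_iff₀ hρ]
      linarith
    linarith
  · have h1 : bmt ω ρ k ≤ Real.exp (k * t₀ + t₀ - ω (M / 2) / ρ) := by
      refine IsWeightFunction.bmt_le hρ k fun t ht => Real.exp_le_exp.2 ?_
      have h2 : (ω (M / 2) + s * (t - t₀)) / ρ ≤ ω (Real.exp t) / ρ := by
        gcongr
        exact hs' t ht
      have h3 : (ω (M / 2) + s * (t - t₀)) / ρ = ω (M / 2) / ρ + s / ρ * (t - t₀) := by ring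
      have h4 : (k - s / ρ) * (t - t₀) ≤ t₀ := by
        rcases le_total t t₀ with h | h
        · nlinarith
        · nlinarith
      nlinarith
    have h2 : t₀ ≤ ω (M / 2) / (2 * ρ) + B₁ / (2 * ρ) := by
      have h3 := h₁ (M / 2) (by linarith)
      have h4 : t₀ ≤ Real.log (1 + M / 2) := Real.log_le_log (by linarith) (by linarith)
      rw [← add_div, le_div_iff₀ (by positivity)]
      nlinarith
    have h3 : c * ω M ≤ ω (M / 2) / (2 * ρ) + c * B := by
      have h4 := hDB M (M / 2) hM (by linarith) (by linarith)
      calc c * ω M ≤ c * (D * ω (M / 2) + B) := by gcongr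
        _ = _ := by rw [hc]; field_simp
    have h4 : ω (M / 2) / ρ = ω (M / 2) / (2 * ρ) + ω (M / 2) / (2 * ρ) := by field_simp; ring
    have hpow : (M / 2) ^ k = Real.exp (k * t₀) := by
      rw [← het, ← Real.exp_nat_mul]
    calc bmt ω ρ k ≤ Real.exp (k * t₀ + t₀ - ω (M / 2) / ρ) := h1
      _ ≤ Real.exp (B₁ / (2 * ρ) + c * B) * Real.exp (-c * ω M) * (M / 2) ^ k := by
          rw [hpow, ← Real.exp_add, ← Real.exp_add, Real.exp_le_exp]
          linarith
      _ ≤ _ := by gcongr; exact le_max_right _ _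

/-- The Fourier coefficients of `g (cos θ)`, up to normalization. -/
def cosCoeff (g : ℝ → ℂ) (m : ℤ) : ℂ :=
  ∫ θ in (0 : ℝ)..(2 * Real.pi), Complex.exp (θ * Complex.I) ^ m * g (Real.cos θ)

lemma norm_cosCoeff_le {g : ℝ → ℂ} {B : ℝ} (hB : ∀ t ∈ Icc (-1 : ℝ) 1, ‖g t‖ ≤ B) (m : ℤ) :
    ‖cosCoeff g m‖ ≤ 2 * Real.pi * B := by
  refine (intervalIntegral.norm_integral_le_of_norm_le_const (C := B) fun θ _ => ?_).trans ?_
  · rw [norm_mul, norm_zpow, Complex.norm_exp_ofReal_mul_I, one_zpow, one_mul]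
    exact hB _ (Real.cos_mem_Icc θ)
  · rw [sub_zero, abs_of_pos Real.two_pi_pos, mul_comm]

lemma hasDerivAt_exp_mul_I_zpow (m : ℤ) (θ : ℝ) :
    HasDerivAt (fun θ : ℝ => Complex.exp (θ * Complex.I) ^ m)
      (m * Complex.I * Complex.exp (θ * Complex.I) ^ m) θ := by
  have h1 : HasDerivAt (fun θ : ℝ => (θ : ℂ)) 1 θ := Complex.ofRealCLM.hasDerivAt
  have h := ((h1.mul_const Complex.I).const_mul (m : ℂ)).cexp
  simp only [Complex.exp_int_mul] at h
  convert h using 1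
  ring

lemma cosCoeff_eq {g g' : ℝ → ℂ} (hg : ∀ t ∈ Icc (-1 : ℝ) 1, HasDerivAt g (g' t) t)
    (hg' : ContinuousOn g' (Icc (-1) 1)) {m : ℤ} (hm : m ≠ 0) :
    cosCoeff g m = -(1 / (2 * m)) * (cosCoeff g' (m + 1) - cosCoeff g' (m - 1)) := by
  have hmC : (m : ℂ) ≠ 0 := by exact_mod_cast hm
  have hexp : ∀ k : ℤ, Continuous fun θ : ℝ => Complex.exp (θ * Complex.I) ^ k := fun k =>
    continuous_iff_continuousAt.2 fun θ => (hasDerivAt_exp_mul_I_zpow k θ).continuousAt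
  have hgc : Continuous fun θ : ℝ => g' (Real.cos θ) :=
    hg'.comp_continuous Real.continuous_cos Real.cos_mem_Icc
  have hu : ∀ θ : ℝ, HasDerivAt (fun θ : ℝ => g (Real.cos θ))
      (-(Real.sin θ : ℂ) * g' (Real.cos θ)) θ := by
    intro θ
    have := (hg _ (Real.cos_mem_Icc θ)).scomp θ (Real.hasDerivAt_cos θ)
    have e : -(Real.sin θ : ℂ) * g' (Real.cos θ) = (-Real.sin θ) • g' (Real.cos θ) := by
      rw [Complex.real_smul, Complex.ofReal_neg]
    rw [e]
    exact this
  have hsin : Continuous fun θ : ℝ => (Real.sin θ : ℂ) :=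
    Complex.continuous_ofReal.comp Real.continuous_sin
  have hv := fun θ : ℝ => hasDerivAt_exp_mul_I_zpow m θ
  have hibp := intervalIntegral.integral_mul_deriv_eq_deriv_mul (a := 0) (b := 2 * Real.pi)
    (fun θ _ => hu θ) (fun θ _ => hv θ) ((hsin.neg.mul hgc).intervalIntegrable _ _)
    ((continuous_const.mul (hexp m)).intervalIntegrable _ _)
  have hper : Complex.exp (((2 * Real.pi : ℝ) : ℂ) * Complex.I) = 1 := by
    push_cast; exact Complex.exp_two_pi_mul_I
  simp only [hper, Real.cos_two_pi, Real.cos_zero, Complex.ofReal_zero, zero_mul, Complex.exp_zero,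
    one_zpow, sub_self, zero_sub] at hibp
  have h1 : ∫ θ in (0 : ℝ)..(2 * Real.pi), g (Real.cos θ) *
      (m * Complex.I * Complex.exp (θ * Complex.I) ^ m) = m * Complex.I * cosCoeff g m := by
    rw [cosCoeff, ← intervalIntegral.integral_const_mul]
    congr 1; funext θ; ring
  have h2 : ∫ θ in (0 : ℝ)..(2 * Real.pi), -(Real.sin θ : ℂ) * g' (Real.cos θ) *
      Complex.exp (θ * Complex.I) ^ m =
      (Complex.I / 2) * (cosCoeff g' (m + 1) - cosCoeff g' (m - 1)) := by
    have hi : ∀ k : ℤ, IntervalIntegrable (fun θ : ℝ => Complex.exp (θ * Complex.I) ^ k *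
        g' (Real.cos θ)) MeasureTheory.volume 0 (2 * Real.pi) := fun k =>
      Continuous.intervalIntegrable ((hexp k).mul hgc) _ _
    rw [cosCoeff, cosCoeff, ← intervalIntegral.integral_sub (hi _) (hi _),
      ← intervalIntegral.integral_const_mul]
    congr 1; funext θ
    have hne : Complex.exp (θ * Complex.I) ≠ 0 := Complex.exp_ne_zero _
    rw [zpow_add_one₀ hne, zpow_sub_one₀ hne, Complex.ofReal_sin, Complex.sin,
      neg_mul (θ : ℂ) Complex.I, Complex.exp_neg]
    ring
  rw [h1, h2] at hibp
  have : Complex.I * (m * cosCoeff g m) =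
      Complex.I * (-(1 / 2) * (cosCoeff g' (m + 1) - cosCoeff g' (m - 1))) := by
    linear_combination hibp
  have := mul_left_cancel₀ Complex.I_ne_zero this
  field_simp
  linear_combination 2 * this

lemma pow_mul_norm_cosCoeff_le {L : ℝ} (hL : 0 ≤ L) (k : ℕ) : ∀ (g : ℕ → ℝ → ℂ) (B : ℝ) (m : ℤ),
    (∀ i, ∀ t ∈ Icc (-1 : ℝ) 1, HasDerivAt (g i) (g (i + 1) t) t) →
    (∀ t ∈ Icc (-1 : ℝ) 1, ‖g k t‖ ≤ B) → L + k ≤ |(m : ℝ)| →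
    L ^ k * ‖cosCoeff (g 0) m‖ ≤ 2 * Real.pi * B := by
  induction k with
  | zero =>
    intro g B m _ hB _
    rw [pow_zero, one_mul]
    exact norm_cosCoeff_le hB m
  | succ k ih =>
    intro g B m hg hB hm
    push_cast at hm
    have hmpos : 0 < |(m : ℝ)| := by
      have : (0 : ℝ) ≤ k := k.cast_nonneg
      linarith
    have hm0 : m ≠ 0 := by
      rintro rfl; simp at hmpos
    have hcont : ContinuousOn (g 1) (Icc (-1) 1) := fun t ht =>
      (hg 1 t ht).continuousAt.continuousWithinAt
    have h1 := ih (fun i => g (i + 1)) B (m + 1) (fun i => hg (i + 1)) hB (by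
      push_cast
      have := abs_sub_abs_le_abs_sub (m : ℝ) (-1)
      rw [sub_neg_eq_add, abs_neg, abs_one] at this
      linarith)
    have h2 := ih (fun i => g (i + 1)) B (m - 1) (fun i => hg (i + 1)) hB (by
      push_cast
      have := abs_sub_abs_le_abs_sub (m : ℝ) 1
      rw [abs_one] at this
      linarith)
    simp only [zero_add] at h1 h2
    have h3 : ‖cosCoeff (g 0) m‖ ≤
        1 / (2 * |(m : ℝ)|) * (‖cosCoeff (g 1) (m + 1)‖ + ‖cosCoeff (g 1) (m - 1)‖) := by
      rw [cosCoeff_eq (hg 0) hcont hm0, norm_mul, norm_neg, norm_div, norm_one, norm_mul,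
        Complex.norm_ofNat, Complex.norm_intCast]
      gcongr
      exact norm_sub_le _ _
    have hLm : L / |(m : ℝ)| ≤ 1 := by
      rw [div_le_one hmpos]
      have : (0 : ℝ) ≤ k := k.cast_nonneg
      linarith
    have hB0 : 0 ≤ 2 * Real.pi * B := (mul_nonneg (by positivity) (norm_nonneg _)).trans h1
    calc L ^ (k + 1) * ‖cosCoeff (g 0) m‖
        ≤ L ^ (k + 1) * (1 / (2 * |(m : ℝ)|) *
          (‖cosCoeff (g 1) (m + 1)‖ + ‖cosCoeff (g 1) (m - 1)‖)) := by gcongr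
      _ = (L / |(m : ℝ)|) * ((L ^ k * ‖cosCoeff (g 1) (m + 1)‖ +
          L ^ k * ‖cosCoeff (g 1) (m - 1)‖) / 2) := by field_simp; ring
      _ ≤ (L / |(m : ℝ)|) * (2 * Real.pi * B) := by gcongr; linarith
      _ ≤ _ := mul_le_of_le_one_left hB0 hLm

/-- Coefficient decay for functions with derivatives bounded by `bmt ω ρ`. -/
lemma IsWeightFunction.exists_norm_cosCoeff_le {ω : ℝ → ℝ} (hω : IsWeightFunction ω) {ρ : ℝ}
    (hρ : 0 < ρ) (C : ℝ) : ∃ A : ℝ, 0 < A ∧ ∃ c : ℝ, 0 < c ∧ ∀ g : ℕ → ℝ → ℂ,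
      (∀ i, ∀ t ∈ Icc (-1 : ℝ) 1, HasDerivAt (g i) (g (i + 1) t) t) →
      (∀ i, ∀ t ∈ Icc (-1 : ℝ) 1, ‖g i t‖ ≤ C * bmt ω ρ i) →
      ∀ m : ℤ, ‖cosCoeff (g 0) m‖ ≤ A * Real.exp (-c * ω |(m : ℝ)|) := by
  obtain ⟨A, hA, c, hc, h⟩ := hω.exists_bmt_le hρ
  refine ⟨2 * Real.pi * (|C| + 1) * A, by positivity, c, hc, fun g hg hgB m => ?_⟩
  obtain ⟨k, hk, hkb⟩ := h |(m : ℝ)| (abs_nonneg _)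
  have h1 := pow_mul_norm_cosCoeff_le (L := |(m : ℝ)| / 2) (by positivity) k g _ m hg (hgB k)
    (by linarith)
  have hpos : 0 < (|(m : ℝ)| / 2) ^ k := by
    rcases Nat.eq_zero_or_pos k with rfl | hk0
    · simp
    · have : (1 : ℝ) ≤ k := by exact_mod_cast hk0
      have : 0 < |(m : ℝ)| / 2 := by linarith
      positivity
  rw [← mul_le_mul_iff_right₀ hpos]
  have hCC : C ≤ |C| + 1 := by linarith [le_abs_self C]
  calc _ ≤ 2 * Real.pi * (C * bmt ω ρ k) := h1
    _ ≤ 2 * Real.pi * ((|C| + 1) * (A * Real.exp (-c * ω |(m : ℝ)|) * (|(m : ℝ)| / 2) ^ k)) := by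
        have := bmt_pos ω ρ k
        gcongr
    _ = _ := by ring

lemma IsWeightFunction.summable_exp_neg_int {ω : ℝ → ℝ} (hω : IsWeightFunction ω) {c : ℝ}
    (hc : 0 < c) : Summable fun m : ℤ => Real.exp (-c * ω |(m : ℝ)|) := by
  rw [← (Equiv.funUnique (Fin 1) ℤ).summable_iff]
  refine (hω.summable_exp_neg hc 1).congr fun m => ?_
  have : ‖m‖ = |((m 0 : ℤ) : ℝ)| := by
    rw [← Int.norm_eq_abs]
    refine le_antisymm ((pi_norm_le_iff_of_nonneg (norm_nonneg _)).2 fun i => ?_)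
      (norm_le_pi_norm m 0)
    rw [Subsingleton.elim i 0]
  rw [this]
  rfl

instance fact_two_pi_pos : Fact (0 < 2 * Real.pi) := ⟨Real.two_pi_pos⟩

lemma fourier_two_pi_apply (m : ℤ) (θ : ℝ) :
    fourier m (θ : AddCircle (2 * Real.pi)) = Complex.exp (θ * Complex.I) ^ m := by
  rw [fourier_coe_apply, ← Complex.exp_int_mul]
  congr 1
  have : (Real.pi : ℂ) ≠ 0 := by exact_mod_cast Real.pi_ne_zero
  push_cast
  field_simp

lemma fourier_re_mem_Icc {T : ℝ} (x : AddCircle T) : (fourier 1 x).re ∈ Icc (-1 : ℝ) 1 := by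
  rw [mem_Icc, ← abs_le]
  refine (Complex.abs_re_le_norm _).trans ?_
  rw [fourier_apply]
  exact (Circle.norm_coe _).le

lemma hasSum_cosCoeff {g : ℝ → ℂ} (hg : ContinuousOn g (Icc (-1) 1))
    (hs : Summable fun m : ℤ => ‖cosCoeff g m‖) (θ : ℝ) :
    HasSum (fun m : ℤ => (1 / (2 * Real.pi) : ℂ) * cosCoeff g (-m) *
      Complex.exp (θ * Complex.I) ^ m) (g (Real.cos θ)) := by
  set Φ : C(AddCircle (2 * Real.pi), ℂ) := ⟨fun x => g ((fourier 1 x).re),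
    hg.comp_continuous (Complex.continuous_re.comp (fourier 1).continuous) fourier_re_mem_Icc⟩
    with hΦ
  have hΦθ : ∀ θ : ℝ, Φ (θ : AddCircle (2 * Real.pi)) = g (Real.cos θ) := by
    intro θ
    simp only [hΦ, ContinuousMap.coe_mk]
    rw [fourier_two_pi_apply, zpow_one, Complex.exp_ofReal_mul_I_re]
  have hcoeff : ∀ m : ℤ, fourierCoeff Φ m = (1 / (2 * Real.pi) : ℂ) * cosCoeff g (-m) := by
    intro m
    rw [fourierCoeff_eq_intervalIntegral _ _ 0, cosCoeff, zero_add, Complex.real_smul]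
    congr 1
    · push_cast; rfl
    · congr 1; funext θ
      rw [hΦθ, fourier_two_pi_apply, smul_eq_mul]
  have hsum : Summable (fourierCoeff Φ) := by
    refine Summable.of_norm ?_
    have h1 := ((Equiv.neg ℤ).summable_iff.2 hs).mul_left ‖(1 / (2 * Real.pi) : ℂ)‖
    refine h1.congr fun m => ?_
    rw [hcoeff, norm_mul]
    rfl
  have h := has_pointwise_sum_fourier_series_of_summable hsum (θ : AddCircle (2 * Real.pi))
  rw [hΦθ] at h
  refine h.congr_fun ?_
  intro m
  rw [hcoeff, fourier_two_pi_apply, smul_eq_mul]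

/-- Trigonometric approximation of functions with decaying Fourier coefficients. -/
lemma IsWeightFunction.exists_polynomial_approx {ω : ℝ → ℝ} (hω : IsWeightFunction ω) {A c : ℝ}
    (hA : 0 < A) (hc : 0 < c) : ∃ A' : ℝ, 0 < A' ∧ ∀ g : ℝ → ℂ, ContinuousOn g (Icc (-1) 1) →
      (∀ m : ℤ, ‖cosCoeff g m‖ ≤ A * Real.exp (-c * ω |(m : ℝ)|)) → ∀ n : ℕ,
      ∃ p : Polynomial ℂ, p.natDegree ≤ 2 * n ∧ ∀ θ : ℝ,
        ‖p.eval (Complex.exp (θ * Complex.I)) -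
          Complex.exp (θ * Complex.I) ^ n * g (Real.cos θ)‖ ≤
            A' * Real.exp (-(c / 2) * ω n) := by
  have hS := hω.summable_exp_neg_int (c := c / 2) (by positivity)
  set S := ∑' m : ℤ, Real.exp (-(c / 2) * ω |(m : ℝ)|) with hSdef
  have hS0 : 0 ≤ S := tsum_nonneg fun m => (Real.exp_pos _).le
  refine ⟨A * S + 1, by positivity, fun g hg hgA n => ?_⟩
  have hsum : Summable fun m : ℤ => ‖cosCoeff g m‖ :=
    Summable.of_nonneg_of_le (fun m => norm_nonneg _) hgA
      ((hω.summable_exp_neg_int hc).mul_left A)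
  set b : ℤ → ℂ := fun m => (1 / (2 * Real.pi) : ℂ) * cosCoeff g (-m) with hb
  have hbA : ∀ m : ℤ, ‖b m‖ ≤ A * Real.exp (-c * ω |(m : ℝ)|) := by
    intro m
    have h1 := hgA (-m)
    rw [Int.cast_neg, abs_neg] at h1
    refine le_trans ?_ h1
    rw [hb, norm_mul]
    refine mul_le_of_le_one_left (norm_nonneg _) ?_
    rw [norm_div, norm_one, norm_mul, Complex.norm_real, Complex.norm_ofNat,
      Real.norm_of_nonneg Real.pi_pos.le, div_le_one (by positivity)]
    linarith [Real.pi_gt_three]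
  refine ⟨∑ k ∈ Finset.range (2 * n + 1), Polynomial.C (b ((k : ℤ) - n)) * Polynomial.X ^ k,
    ?_, fun θ => ?_⟩
  · refine Polynomial.natDegree_sum_le_of_forall_le _ _ fun k hk => ?_
    exact (Polynomial.natDegree_C_mul_X_pow_le _ _).trans
      (Nat.lt_succ_iff.1 (Finset.mem_range.1 hk))
  · set w := Complex.exp (θ * Complex.I) with hw
    have hw0 : w ≠ 0 := Complex.exp_ne_zero _
    have hw1 : ‖w‖ = 1 := Complex.norm_exp_ofReal_mul_I θ
    set s : Finset ℤ := (Finset.range (2 * n + 1)).image fun k : ℕ => (k : ℤ) - n with hs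
    have hmem : ∀ m : ℤ, m ∉ s → (n : ℝ) ≤ |(m : ℝ)| := by
      intro m hm
      by_contra hlt
      have hlt' : |m| < (n : ℤ) := by
        have := not_le.1 hlt
        rw [← Int.cast_abs] at this
        exact_mod_cast this
      rw [abs_lt] at hlt'
      apply hm
      refine Finset.mem_image.2 ⟨(m + n).toNat, Finset.mem_range.2 ?_, ?_⟩ <;> lia
    have hp : (∑ k ∈ Finset.range (2 * n + 1),
        Polynomial.C (b ((k : ℤ) - n)) * Polynomial.X ^ k).eval w = w ^ n * ∑ m ∈ s, b m * w ^ m := by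
      rw [hs, Finset.sum_image (by intro x _ y _ h; simpa using h), Polynomial.eval_finsetSum,
        Finset.mul_sum]
      refine Finset.sum_congr rfl fun k _ => ?_
      rw [Polynomial.eval_mul, Polynomial.eval_C, Polynomial.eval_pow, Polynomial.eval_X,
        zpow_sub₀ hw0, zpow_natCast, zpow_natCast]
      field_simp
    have h1 := hasSum_cosCoeff hg hsum θ
    have h2 : HasSum (fun m => if m ∈ s then b m * w ^ m else 0) (∑ m ∈ s, b m * w ^ m) := by
      rw [← Finset.sum_congr rfl fun m hm => if_pos hm]
      exact hasSum_sum_of_ne_finset_zero fun m hm => if_neg hm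
    have h3 := h2.sub h1
    have h4 : HasSum (fun m : ℤ => A * Real.exp (-(c / 2) * ω n) *
        Real.exp (-(c / 2) * ω |(m : ℝ)|)) (A * Real.exp (-(c / 2) * ω n) * S) :=
      hS.hasSum.mul_left _
    have h5 : ‖∑ m ∈ s, b m * w ^ m - g (Real.cos θ)‖ ≤ A * Real.exp (-(c / 2) * ω n) * S := by
      rw [← h3.tsum_eq]
      refine tsum_of_norm_bounded h4 fun m => ?_
      by_cases hm : m ∈ s
      · rw [if_pos hm, sub_self, norm_zero]
        positivity
      · rw [if_neg hm, zero_sub, norm_neg, norm_mul, norm_zpow, hw1, one_zpow, mul_one]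
        refine (hbA m).trans ?_
        rw [mul_assoc, ← Real.exp_add]
        have := hω.mono (mem_Ici.2 n.cast_nonneg) (mem_Ici.2 (abs_nonneg (m : ℝ))) (hmem m hm)
        gcongr
        nlinarith
    rw [hp, ← mul_sub, norm_mul, norm_pow, hw1, one_pow, one_mul]
    refine h5.trans ?_
    nlinarith [Real.exp_pos (-(c / 2) * ω n)]

lemma cosCoeff_neg (g : ℝ → ℂ) (m : ℤ) : cosCoeff g (-m) = cosCoeff g m := by
  have h := intervalIntegral.integral_comp_sub_left
    (fun θ : ℝ => Complex.exp (θ * Complex.I) ^ m * g (Real.cos θ)) (a := 0) (b := 2 * Real.pi)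
    (2 * Real.pi)
  rw [sub_self, sub_zero] at h
  rw [cosCoeff, cosCoeff, ← h]
  congr 1; funext θ
  rw [Real.cos_two_pi_sub, zpow_neg, ← inv_zpow, ← Complex.exp_neg]
  congr 2
  push_cast
  rw [sub_mul, Complex.exp_sub, Complex.exp_two_pi_mul_I, Complex.exp_neg, one_div]

lemma IsWeightFunction.exists_succ_le {ω : ℝ → ℝ} (hω : IsWeightFunction ω) :
    ∃ D : ℝ, 1 ≤ D ∧ ∃ B : ℝ, 0 ≤ B ∧ ∀ n : ℕ, ω ((n : ℝ) + 1) ≤ D * ω n + B := by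
  obtain ⟨D, hD, B, hB, h⟩ := hω.exists_mul_le 2
  have h1 := hω.nonneg 1 zero_le_one
  refine ⟨D, hD, B + ω 1, by linarith, fun n => ?_⟩
  rcases Nat.eq_zero_or_pos n with rfl | hn
  · have := mul_nonneg (zero_le_one.trans hD) (hω.nonneg 0 le_rfl)
    simp only [CharP.cast_eq_zero, zero_add]
    linarith
  · have hn1 : (1 : ℝ) ≤ n := by exact_mod_cast hn
    have := h ((n : ℝ) + 1) n (by linarith) (by linarith) (by linarith)
    linarith

/-- One-dimensional form of the theorem, in terms of Fourier coefficients. -/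
lemma IsWeightFunction.exists_norm_cosCoeff_le_of_pow {ω : ℝ → ℝ} (hω : IsWeightFunction ω) {j : ℕ}
    (hj : 1 ≤ j) {K : ℝ} (hK : 0 ≤ K) {ρ : ℝ} (hρ : 0 < ρ) (C : ℝ) :
    ∃ A : ℝ, 0 < A ∧ ∃ c : ℝ, 0 < c ∧ ∀ (f : ℝ → ℂ) (g h : ℕ → ℝ → ℂ),
      ContinuousOn f (Icc (-1) 1) → (∀ t ∈ Icc (-1 : ℝ) 1, ‖f t‖ ≤ K) →
      (∀ t ∈ Icc (-1 : ℝ) 1, g 0 t = f t ^ j) → (∀ t ∈ Icc (-1 : ℝ) 1, h 0 t = f t ^ (j + 1)) →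
      (∀ i, ∀ t ∈ Icc (-1 : ℝ) 1, HasDerivAt (g i) (g (i + 1) t) t) →
      (∀ i, ∀ t ∈ Icc (-1 : ℝ) 1, HasDerivAt (h i) (h (i + 1) t) t) →
      (∀ i, ∀ t ∈ Icc (-1 : ℝ) 1, ‖g i t‖ ≤ C * bmt ω ρ i) →
      (∀ i, ∀ t ∈ Icc (-1 : ℝ) 1, ‖h i t‖ ≤ C * bmt ω ρ i) →
      ∀ m : ℤ, ‖cosCoeff f m‖ ≤ A * Real.exp (-c * ω |(m : ℝ)|) := by
  obtain ⟨A₁, hA₁, c₁, hc₁, h₁⟩ := hω.exists_norm_cosCoeff_le hρ C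
  obtain ⟨A₂, hA₂, h₂⟩ := hω.exists_polynomial_approx hA₁ hc₁
  obtain ⟨C₀, hC₀, h₀⟩ := exists_norm_integral_le_of_approx hj hK
  obtain ⟨D, hD, B, hB, hDB⟩ := hω.exists_succ_le
  have hJ : (1 : ℝ) ≤ ((j * (j + 1) : ℕ) : ℝ) := by
    exact_mod_cast Nat.mul_pos hj (Nat.succ_pos j)
  set J : ℝ := ((j * (j + 1) : ℕ) : ℝ) with hJdef
  set c₂ : ℝ := c₁ / (4 * J) with hc₂def
  have hc₂ : 0 < c₂ := by positivity
  have hc₂J : c₂ * J = c₁ / 4 := by rw [hc₂def]; field_simp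
  have hc₂1 : c₂ ≤ c₁ / 4 := by nlinarith
  obtain ⟨B₁, hB₁, hlog⟩ := hω.exists_mul_log_le (A := 2 / c₂) (by positivity)
  have hD0 : 0 < D := by linarith
  have hpi := Real.pi_pos
  set c := c₂ / (2 * D) with hcdef
  have hc : 0 < c := by positivity
  set A₃ := C₀ * Real.exp (c₂ / 2 * B₁) + 2 * Real.pi * K * (C₀ * A₂) with hA₃
  have hA₃0 : 0 < A₃ := by positivity
  refine ⟨A₃ * Real.exp (c * B) + 2 * Real.pi * K * Real.exp (c * ω 0), by positivity, c, hc, ?_⟩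
  intro f g h hf hfK hg0 hh0 hg hh hgC hhC
  have hgp := h₂ (g 0) (fun t ht => (hg 0 t ht).continuousAt.continuousWithinAt) (h₁ g hg hgC)
  have hhp := h₂ (h 0) (fun t ht => (hh 0 t ht).continuousAt.continuousWithinAt) (h₁ h hh hhC)
  have hnat : ∀ n : ℕ, ‖cosCoeff f ((n + 1 : ℕ) : ℤ)‖ ≤ A₃ * Real.exp (-(c₂ / 2) * ω n) := by
    intro n
    have hωn := hω.nonneg n n.cast_nonneg
    obtain ⟨p, hpd, hp⟩ := hgp n
    obtain ⟨q, -, hq⟩ := hhp n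
    set δ := A₂ * Real.exp (-(c₁ / 2) * ω n) with hδ
    set τ := Real.exp (-c₂ * ω n) with hτ
    have hτJ : τ ^ (j * (j + 1)) = Real.exp (-(c₁ / 4) * ω n) := by
      rw [hτ, ← Real.exp_nat_mul, ← hJdef, ← hc₂J]
      congr 1; ring
    have hE : (0 : ℝ) < Real.exp (-(c₂ / 2) * ω n) := Real.exp_pos _
    by_cases hcase : C₀ * δ ≤ τ ^ (j * (j + 1))
    · have hb := h₀ n τ δ (fun θ => f (Real.cos θ)) p q (Real.exp_pos _)
        (Real.exp_le_one_iff.2 (by nlinarith)) hcase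
        (hf.comp_continuous Real.continuous_cos Real.cos_mem_Icc)
        (fun θ => hfK _ (Real.cos_mem_Icc θ)) hpd
        (fun θ => by rw [← hg0 _ (Real.cos_mem_Icc θ)]; exact hp θ)
        (fun θ => by rw [← hh0 _ (Real.cos_mem_Icc θ)]; exact hq θ)
      have heq : cosCoeff f ((n + 1 : ℕ) : ℤ) = ∫ θ in (0 : ℝ)..(2 * Real.pi),
          Complex.exp (θ * Complex.I) ^ (n + 1) * f (Real.cos θ) := by
        simp only [cosCoeff, zpow_natCast]
      rw [heq]
      have hn1 : (n : ℝ) + 1 ≤ Real.exp (c₂ / 2 * B₁ + c₂ / 2 * ω n) := by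
        have h3 := hlog n n.cast_nonneg
        have h4 : Real.log (1 + n) ≤ c₂ / 2 * (ω n + B₁) := by
          have := mul_le_mul_of_nonneg_left h3 (by positivity : 0 ≤ c₂ / 2)
          rwa [← mul_assoc, show c₂ / 2 * (2 / c₂) = 1 by field_simp, one_mul] at this
        rw [Real.log_le_iff_le_exp (by positivity)] at h4
        rw [add_comm (n : ℝ), ← mul_add, add_comm B₁]
        exact h4
      calc _ ≤ C₀ * (n + 1) * τ := hb
        _ ≤ C₀ * Real.exp (c₂ / 2 * B₁ + c₂ / 2 * ω n) * τ := by gcongr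
        _ = C₀ * Real.exp (c₂ / 2 * B₁) * Real.exp (-(c₂ / 2) * ω n) := by
            rw [mul_assoc, mul_assoc, hτ, ← Real.exp_add, ← Real.exp_add]
            congr 2; ring
        _ ≤ _ := by
            gcongr
            rw [hA₃]
            have : 0 ≤ 2 * Real.pi * K * (C₀ * A₂) := by positivity
            linarith
    · have hlt := not_le.1 hcase
      rw [hτJ, hδ, show -(c₁ / 2) * ω n = -(c₁ / 4) * ω n + -(c₁ / 4) * ω n by ring, Real.exp_add,
        ← mul_assoc, ← mul_assoc] at hlt
      have h3 : 1 ≤ C₀ * A₂ * Real.exp (-(c₁ / 4) * ω n) := by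
        by_contra hneg
        have h4 := mul_lt_mul_of_pos_right (not_le.1 hneg) (Real.exp_pos (-(c₁ / 4) * ω n))
        rw [one_mul] at h4
        linarith
      have h4 : Real.exp (-(c₁ / 4) * ω n) ≤ Real.exp (-(c₂ / 2) * ω n) := by
        rw [Real.exp_le_exp]
        nlinarith
      have h5 : 1 ≤ C₀ * A₂ * Real.exp (-(c₂ / 2) * ω n) := h3.trans (by gcongr)
      calc _ ≤ 2 * Real.pi * K := norm_cosCoeff_le hfK _
        _ ≤ 2 * Real.pi * K * (C₀ * A₂ * Real.exp (-(c₂ / 2) * ω n)) :=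
            le_mul_of_one_le_right (by positivity) h5
        _ = 2 * Real.pi * K * (C₀ * A₂) * Real.exp (-(c₂ / 2) * ω n) := by ring
        _ ≤ _ := by
            gcongr
            rw [hA₃]
            have : 0 ≤ C₀ * Real.exp (c₂ / 2 * B₁) := by positivity
            linarith
  have hnat_alt : ∀ n : ℕ, ‖cosCoeff f n‖ ≤
      (A₃ * Real.exp (c * B) + 2 * Real.pi * K * Real.exp (c * ω 0)) * Real.exp (-c * ω n) := by
    intro n
    rw [add_mul]
    rcases n with _ | n
    · have h3 : 2 * Real.pi * K * Real.exp (c * ω 0) * Real.exp (-c * ω ((0 : ℕ) : ℝ)) =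
          2 * Real.pi * K := by
        rw [mul_assoc, ← Real.exp_add, Nat.cast_zero, neg_mul, add_neg_cancel, Real.exp_zero,
          mul_one]
      rw [h3]
      have : 0 ≤ A₃ * Real.exp (c * B) * Real.exp (-c * ω ((0 : ℕ) : ℝ)) := by positivity
      linarith [norm_cosCoeff_le hfK ((0 : ℕ) : ℤ)]
    · have h3 : 0 ≤ 2 * Real.pi * K * Real.exp (c * ω 0) *
          Real.exp (-c * ω ((n + 1 : ℕ) : ℝ)) := by positivity
      have h4 : Real.exp (-(c₂ / 2) * ω n) ≤
          Real.exp (c * B) * Real.exp (-c * ω ((n + 1 : ℕ) : ℝ)) := by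
        rw [← Real.exp_add, Real.exp_le_exp]
        have h5 := mul_le_mul_of_nonneg_left (hDB n) hc.le
        have h6 : c * (D * ω n + B) = c₂ / 2 * ω n + c * B := by rw [hcdef]; field_simp
        push_cast
        linarith
      calc _ ≤ A₃ * Real.exp (-(c₂ / 2) * ω n) := hnat n
        _ ≤ A₃ * (Real.exp (c * B) * Real.exp (-c * ω ((n + 1 : ℕ) : ℝ))) := by gcongr
        _ ≤ _ := by linarith
  intro m
  obtain ⟨n, rfl | rfl⟩ := m.eq_nat_or_neg
  · simpa using hnat_alt n
  · rw [cosCoeff_neg]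
    simpa using hnat_alt n

/-- A Fourier coefficient on the torus is bounded by the coefficients of the slices in one fixed
coordinate direction. -/
lemma norm_mFourierCoeff_le {d : Type*} [Fintype d] [DecidableEq d] (F : C(UnitAddTorus d, ℂ))
    (n : d → ℤ) (i : d) {B : ℝ}
    (h : ∀ t : UnitAddTorus d,
      ‖fourierCoeff (fun s : UnitAddCircle => F (Function.update t i s)) (n i)‖ ≤ B) :
    ‖UnitAddTorus.mFourierCoeff F n‖ ≤ B := by
  let μ : MeasureTheory.Measure (UnitAddTorus d) :=
    MeasureTheory.Measure.pi fun _ => AddCircle.haarAddCircle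
  have hcoeff : UnitAddTorus.mFourierCoeff F n =
      ∫ t, UnitAddTorus.mFourier (-n) t * F t ∂μ := rfl
  have hsingle : ∀ (t : UnitAddTorus d) (s : UnitAddCircle),
      UnitAddTorus.mFourier (-n) (t + Pi.single i s) =
        UnitAddTorus.mFourier (-n) t * fourier (-n i) s := by
    intro t s
    simp only [UnitAddTorus.mFourier, ContinuousMap.coe_mk, Pi.add_apply, Pi.neg_apply]
    rw [← Finset.mul_prod_erase _ _ (Finset.mem_univ i),
      ← Finset.mul_prod_erase Finset.univ (fun j => fourier (-n j) (t j)) (Finset.mem_univ i)]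
    rw [Finset.prod_congr rfl fun j hj => by
      rw [Pi.single_eq_of_ne (Finset.ne_of_mem_erase hj), add_zero]]
    simp only [Pi.single_eq_same, fourier_apply, smul_add, AddCircle.toCircle_add, Circle.coe_mul]
    ring
  have hcont : Continuous fun p : UnitAddCircle × UnitAddTorus d =>
      UnitAddTorus.mFourier (-n) (p.2 + Pi.single i p.1) * F (p.2 + Pi.single i p.1) := by
    have : Continuous fun p : UnitAddCircle × UnitAddTorus d =>
        p.2 + (Pi.single i p.1 : UnitAddTorus d) :=
      continuous_snd.add ((continuous_single i).comp continuous_fst)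
    exact ((UnitAddTorus.mFourier (-n)).continuous.comp this).mul (F.continuous.comp this)
  have hinner : ∀ t : UnitAddTorus d, ‖∫ s, UnitAddTorus.mFourier (-n) (t + Pi.single i s) *
      F (t + Pi.single i s) ∂(AddCircle.haarAddCircle (T := (1 : ℝ)))‖ ≤ B := by
    intro t
    refine le_of_eq_of_le ?_ (h t)
    have hshift : fourierCoeff (fun s : UnitAddCircle => F (Function.update t i s)) (n i) =
        fourier (-n i) (t i) * ∫ s, fourier (-n i) s * F (t + Pi.single i s)
          ∂(AddCircle.haarAddCircle (T := (1 : ℝ))) := by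
      rw [fourierCoeff, ← MeasureTheory.integral_add_left_eq_self _ (t i),
        ← MeasureTheory.integral_const_mul]
      congr 1; funext s
      have hupd : Function.update t i (t i + s) = t + Pi.single i s := by
        funext k
        rcases eq_or_ne k i with rfl | hk
        · simp
        · simp [hk]
      rw [hupd, smul_eq_mul, fourier_apply, smul_add, AddCircle.toCircle_add, Circle.coe_mul,
        fourier_apply, fourier_apply, mul_assoc]
    rw [hshift, norm_mul]
    simp_rw [hsingle, mul_assoc]
    rw [MeasureTheory.integral_const_mul, norm_mul, fourier_apply, Circle.norm_coe, one_mul]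
    have hone : ‖UnitAddTorus.mFourier (-n) t‖ = 1 := by
      rw [UnitAddTorus.mFourier, ContinuousMap.coe_mk, norm_prod]
      exact Finset.prod_eq_one fun k _ => by rw [fourier_apply, Circle.norm_coe]
    rw [hone, one_mul]
  have hint : UnitAddTorus.mFourierCoeff F n = ∫ t, ∫ s,
      UnitAddTorus.mFourier (-n) (t + Pi.single i s) * F (t + Pi.single i s)
        ∂(AddCircle.haarAddCircle (T := (1 : ℝ))) ∂μ := by
    rw [← MeasureTheory.integral_integral_swap]
    · simp_rw [MeasureTheory.integral_add_right_eq_self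
        (fun t => UnitAddTorus.mFourier (-n) t * F t), ← hcoeff]
      simp
    · exact hcont.integrable_of_hasCompactSupport (HasCompactSupport.of_compactSpace _)
  rw [hint]
  refine (MeasureTheory.norm_integral_le_of_norm_le_const (MeasureTheory.ae_of_all _ hinner)).trans_eq ?_
  simp

lemma fourierCoeff_comp_cos (g : ℝ → ℂ) (m : ℤ) :
    fourierCoeff (fun s : UnitAddCircle => g (fourier 1 s).re) m =
      (2 * Real.pi)⁻¹ * cosCoeff g (-m) := by
  rw [fourierCoeff_eq_intervalIntegral _ _ 0, zero_add, div_one, one_smul, cosCoeff]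
  have h := intervalIntegral.integral_comp_mul_left (a := 0) (b := 1) (fun θ : ℝ =>
    Complex.exp (θ * Complex.I) ^ (-m) * g (Real.cos θ)) (c := 2 * Real.pi) (by positivity)
  rw [mul_zero, mul_one, Complex.real_smul] at h
  push_cast at h ⊢
  rw [← h]
  congr 1; funext s
  have h1 : fourier (T := (1 : ℝ)) 1 (s : UnitAddCircle) =
      Complex.exp ((2 * Real.pi * s : ℝ) * Complex.I) := by
    rw [fourier_coe_apply]; congr 1; push_cast; ring
  rw [smul_eq_mul, h1, Complex.exp_ofReal_mul_I_re, fourier_coe_apply, ← Complex.exp_int_mul]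
  congr 2
  push_cast; ring

lemma norm_mFourierCoeff_le_of_norm_le {d : Type*} [Fintype d] (F : C(UnitAddTorus d, ℂ))
    (n : d → ℤ) {K : ℝ} (h : ∀ t, ‖F t‖ ≤ K) : ‖UnitAddTorus.mFourierCoeff F n‖ ≤ K := by
  let μ : MeasureTheory.Measure (UnitAddTorus d) :=
    MeasureTheory.Measure.pi fun _ => AddCircle.haarAddCircle
  have hcoeff : UnitAddTorus.mFourierCoeff F n =
      ∫ t, UnitAddTorus.mFourier (-n) t * F t ∂μ := rfl
  rw [hcoeff]
  refine (MeasureTheory.norm_integral_le_of_norm_le_const (C := K)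
    (MeasureTheory.ae_of_all _ fun t => ?_)).trans_eq (by simp)
  rw [norm_mul]
  have hone : ‖UnitAddTorus.mFourier (-n) t‖ ≤ 1 :=
    ((UnitAddTorus.mFourier (-n)).norm_coe_le_norm t).trans_eq UnitAddTorus.mFourier_norm
  exact (mul_le_of_le_one_left (norm_nonneg _) hone).trans (h t)

/-- The average of `mFourier m` over all sign changes of the coordinates is a product of Chebyshev
polynomials. -/
lemma sum_mFourier_cond {d : Type*} [Fintype d] [DecidableEq d] (m : d → ℤ) (θ : d → ℝ) :
    ∑ ε : d → Bool, UnitAddTorus.mFourier m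
        (fun i => ((cond (ε i) (θ i / (2 * Real.pi)) (-(θ i / (2 * Real.pi))) : ℝ) :
          UnitAddCircle)) =
      2 ^ Fintype.card d *
        ∏ i, (Polynomial.Chebyshev.T ℂ (m i)).eval ((Real.cos (θ i) : ℝ) : ℂ) := by
  have hpi : (Real.pi : ℂ) ≠ 0 := by exact_mod_cast Real.pi_ne_zero
  have h := Finset.prod_univ_sum (fun _ : d => (Finset.univ : Finset Bool)) (fun i b =>
    fourier (T := (1 : ℝ)) (m i)
      ((cond b (θ i / (2 * Real.pi)) (-(θ i / (2 * Real.pi))) : ℝ) : UnitAddCircle))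
  rw [Fintype.piFinset_univ] at h
  simp only [UnitAddTorus.mFourier, ContinuousMap.coe_mk]
  rw [← h, ← Finset.card_univ, ← Finset.prod_const, ← Finset.prod_mul_distrib]
  refine Finset.prod_congr rfl fun i _ => ?_
  rw [Fintype.sum_bool, Complex.ofReal_cos, Polynomial.Chebyshev.T_complex_cos,
    Complex.two_cos, cond_true, cond_false, fourier_coe_apply, fourier_coe_apply]
  congr 2 <;> push_cast <;> field_simp

/-- Expansion of a function on a cube in a multiple Chebyshev series. -/
lemma IsWeightFunction.exists_hasSum_chebyshev {ω : ℝ → ℝ} (hω : IsWeightFunction ω) {d : ℕ}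
    {F : (Fin d → ℝ) → ℂ} (hF : ContinuousOn F (Icc (-1) 1)) {A c : ℝ} (hA : 0 < A) (hc : 0 < c)
    (h : ∀ i, ∀ y ∈ Icc (-1 : Fin d → ℝ) 1, ∀ m : ℤ,
      ‖cosCoeff (fun s => F (Function.update y i s)) m‖ ≤ A * Real.exp (-c * ω |(m : ℝ)|)) :
    ∃ A' : ℝ, 0 < A' ∧ ∃ a : (Fin d → ℤ) → ℂ,
      (∀ m, ‖a m‖ ≤ A' * Real.exp (-c * ω ‖m‖)) ∧ ∀ y ∈ Icc (-1 : Fin d → ℝ) 1,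
        HasSum (fun m => a m * ∏ i, (Polynomial.Chebyshev.T ℂ (m i)).eval ((y i : ℝ) : ℂ))
          (F y) := by
  obtain ⟨K, hK⟩ := (isCompact_Icc (a := (-1 : Fin d → ℝ)) (b := 1)).exists_bound_of_continuousOn hF
  have hmem : ∀ t : UnitAddTorus (Fin d), (fun i => (fourier 1 (t i)).re) ∈
      Icc (-1 : Fin d → ℝ) 1 := fun t =>
    ⟨fun i => (fourier_re_mem_Icc (t i)).1, fun i => (fourier_re_mem_Icc (t i)).2⟩
  let G : C(UnitAddTorus (Fin d), ℂ) :=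
    ⟨fun t => F fun i => (fourier 1 (t i)).re, hF.comp_continuous (by fun_prop) hmem⟩
  have hK0 : 0 ≤ K := (norm_nonneg _).trans (hK 0 ⟨fun i => by simp, fun i => by simp⟩)
  have hcoeff : ∀ m, ‖UnitAddTorus.mFourierCoeff G m‖ ≤
      (A + K * Real.exp (c * ω 0)) * Real.exp (-c * ω ‖m‖) := by
    intro m
    rw [add_mul]
    by_cases hm : m = 0
    · have h1 := norm_mFourierCoeff_le_of_norm_le G m (K := K) fun t => hK _ (hmem t)
      have h2 : K * Real.exp (c * ω 0) * Real.exp (-c * ω ‖m‖) = K := by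
        rw [hm, norm_zero, mul_assoc, ← Real.exp_add]; simp
      have h3 : 0 ≤ A * Real.exp (-c * ω ‖m‖) := by positivity
      linarith
    · obtain ⟨i, hi⟩ : ∃ i, ‖m‖ = |(m i : ℝ)| := by
        obtain ⟨i₀, -⟩ := Function.ne_iff.1 hm
        have : Nonempty (Fin d) := ⟨i₀⟩
        obtain ⟨i, hi⟩ := Finite.exists_max fun i => ‖m i‖
        refine ⟨i, le_antisymm ((pi_norm_le_iff_of_nonneg (abs_nonneg _)).2 fun k => ?_) ?_⟩
        · exact (hi k).trans_eq (Int.norm_eq_abs _)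
        · rw [← Int.norm_eq_abs]; exact norm_le_pi_norm m i
      have h1 : ‖UnitAddTorus.mFourierCoeff G m‖ ≤ A * Real.exp (-c * ω ‖m‖) := by
        refine norm_mFourierCoeff_le G m i fun t => ?_
        let φ : ℝ → ℂ := fun x => F (Function.update (fun k => (fourier 1 (t k)).re) i x)
        have h2 : (fun s : UnitAddCircle => G (Function.update t i s)) = fun s =>
            φ (fourier 1 s).re := by
          funext s
          change F _ = F _
          congr 1; funext k
          rcases eq_or_ne k i with rfl | hk
          · simp
          · simp [hk]
        rw [h2, fourierCoeff_comp_cos φ, norm_mul, hi]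
        have h3 := h i _ (hmem t) (-m i)
        rw [Int.cast_neg, abs_neg] at h3
        refine (mul_le_of_le_one_left (norm_nonneg _) ?_).trans h3
        have : 1 ≤ 2 * Real.pi := by linarith [Real.pi_gt_three]
        rw [Complex.norm_real, norm_inv, Real.norm_eq_abs, abs_of_pos Real.two_pi_pos]
        exact inv_le_one_of_one_le₀ this
      have h2 : 0 ≤ K * Real.exp (c * ω 0) * Real.exp (-c * ω ‖m‖) := by positivity
      linarith
  refine ⟨A + K * Real.exp (c * ω 0), by positivity, UnitAddTorus.mFourierCoeff G, hcoeff, ?_⟩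
  have hsum : Summable (UnitAddTorus.mFourierCoeff G) :=
    .of_norm_bounded ((hω.summable_exp_neg hc d).mul_left _) hcoeff
  intro y hy
  have hcos : ∀ i, Real.cos (Real.arccos (y i)) = y i := fun i => Real.cos_arccos (hy.1 i) (hy.2 i)
  have hε : ∀ ε : Fin d → Bool, HasSum (fun m => UnitAddTorus.mFourierCoeff G m *
      UnitAddTorus.mFourier m (fun i => ((cond (ε i) (Real.arccos (y i) / (2 * Real.pi))
        (-(Real.arccos (y i) / (2 * Real.pi))) : ℝ) : UnitAddCircle))) (F y) := by
    intro ε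
    have hs := UnitAddTorus.hasSum_mFourier_series_apply_of_summable hsum
      (fun i => ((cond (ε i) (Real.arccos (y i) / (2 * Real.pi))
        (-(Real.arccos (y i) / (2 * Real.pi))) : ℝ) : UnitAddCircle))
    refine (congrArg (HasSum _) ?_).mp hs
    change F _ = F y
    congr 1; funext i
    rw [fourier_coe_apply]
    rw [show (2 * Real.pi * Complex.I * ((1 : ℤ) : ℂ) * ((cond (ε i)
      (Real.arccos (y i) / (2 * Real.pi)) (-(Real.arccos (y i) / (2 * Real.pi))) : ℝ) : ℂ) /
      ((1 : ℝ) : ℂ)) = ((cond (ε i) (Real.arccos (y i)) (-Real.arccos (y i)) : ℝ) : ℂ) * Complex.I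
      from ?_, Complex.exp_ofReal_mul_I_re]
    · cases ε i <;> simp [hcos]
    · have hpi : (Real.pi : ℂ) ≠ 0 := by exact_mod_cast Real.pi_ne_zero
      cases ε i <;> simp only [cond_true, cond_false] <;> push_cast <;> field_simp
  have h1 := (hasSum_sum fun ε (_ : ε ∈ (Finset.univ : Finset (Fin d → Bool))) => hε ε).mul_left
    ((2 : ℂ) ^ d)⁻¹
  have h2d : (2 : ℂ) ^ d ≠ 0 := pow_ne_zero _ two_ne_zero
  simp only [← Finset.mul_sum, sum_mFourier_cond, hcos] at h1
  have h3 : ((2 : ℂ) ^ d)⁻¹ * ∑ _ : Fin d → Bool, F y = F y := by simp [h2d]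
  rw [h3] at h1
  refine h1.congr_fun fun m => ?_
  rw [Fintype.card_fin]
  field_simp

/-- Termwise differentiation of a series of smooth functions on a preconnected open set. -/
lemma contDiffOn_of_hasSum_of_summable {ι E F : Type*} [NormedAddCommGroup E] [NormedSpace ℝ E]
    [NormedAddCommGroup F] [NormedSpace ℝ F] [CompleteSpace F] {ψ : ι → E → F}
    (hψ : ∀ i, ContDiff ℝ (⊤ : ℕ∞) (ψ i)) {V : Set E} (hV : IsOpen V) (hV' : IsPreconnected V)
    {u : ℕ → ι → ℝ} (hu : ∀ k, Summable (u k))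
    (hb : ∀ k i, ∀ x ∈ V, ‖iteratedFDeriv ℝ k (ψ i) x‖ ≤ u k i) {f : E → F}
    (hf : ∀ x ∈ V, HasSum (fun i => ψ i x) (f x)) :
    ContDiffOn ℝ (⊤ : ℕ∞) f V ∧
      ∀ k, ∀ x ∈ V, ‖iteratedFDerivWithin ℝ k f V x‖ ≤ ∑' i, u k i := by
  have hsum : ∀ k, ∀ x ∈ V, Summable fun i => iteratedFDeriv ℝ k (ψ i) x := fun k x hx =>
    .of_norm_bounded (hu k) fun i => hb k i x hx
  let p : E → FormalMultilinearSeries ℝ E F := fun x k => ∑' i, iteratedFDeriv ℝ k (ψ i) x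
  have hderiv : ∀ k, ∀ x ∈ V, HasFDerivAt (fun y => p y k) (p x (k + 1)).curryLeft x := by
    intro k x hx
    have hk : ((k : ℕ∞) : WithTop ℕ∞) < ((⊤ : ℕ∞) : WithTop ℕ∞) := by
      exact_mod_cast ENat.natCast_lt_top k
    have hdiff : ∀ i, Differentiable ℝ (iteratedFDeriv ℝ k (ψ i)) := fun i =>
      (hψ i).differentiable_iteratedFDeriv hk
    have h1 := hasFDerivAt_tsum_of_isPreconnected (𝕜 := ℝ)
      (f := fun i y => iteratedFDeriv ℝ k (ψ i) y)
      (f' := fun i y => fderiv ℝ (iteratedFDeriv ℝ k (ψ i)) y) (hu (k + 1)) hV hV'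
      (fun i y _ => (hdiff i y).hasFDerivAt)
      (fun i y hy => by rw [norm_fderiv_iteratedFDeriv]; exact hb (k + 1) i y hy) hx (hsum k x hx) hx
    have h2 := (continuousMultilinearCurryLeftEquiv ℝ (fun _ : Fin (k + 1) => E)
      F).toContinuousLinearEquiv.toContinuousLinearMap.map_tsum (hsum (k + 1) x hx)
    have h3 : (p x (k + 1)).curryLeft = ∑' i, fderiv ℝ (iteratedFDeriv ℝ k (ψ i)) x := by
      refine h2.trans (tsum_congr fun i => ?_)
      rw [fderiv_iteratedFDeriv]
      rfl
    rw [h3]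
    exact h1
  have hT : HasFTaylorSeriesUpToOn ((⊤ : ℕ∞) : WithTop ℕ∞) f p V :=
    { zero_eq := fun x hx => by
        have h2 := (continuousMultilinearCurryFin0 ℝ E
          F).toContinuousLinearEquiv.toContinuousLinearMap.map_tsum (hsum 0 x hx)
        exact h2.trans (hf x hx).tsum_eq
      fderivWithin := fun k _ x hx => (hderiv k x hx).hasFDerivWithinAt
      cont := fun k _ x hx => (hderiv k x hx).continuousAt.continuousWithinAt }
  refine ⟨hT.contDiffOn, fun k x hx => ?_⟩
  rw [← hT.eq_iteratedFDerivWithin_of_uniqueDiffOn (by exact_mod_cast le_top) hV.uniqueDiffOn hx]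
  exact tsum_of_norm_bounded (hu k).hasSum fun i => hb k i x hx

lemma norm_iteratedFDeriv_prod_le_factorial {ι E : Type*} [NormedAddCommGroup E] [NormedSpace ℝ E]
    {φ : ι → E → ℂ} (hφ : ∀ i, ContDiff ℝ (⊤ : ℕ∞) (φ i)) {x : E} {A : ℝ} (hA : 0 ≤ A)
    {κ : ι → ℝ} (hκ : ∀ i, 0 ≤ κ i)
    (h : ∀ i k, ‖iteratedFDeriv ℝ k (φ i) x‖ ≤ k.factorial * A ^ k * κ i) (s : Finset ι) (k : ℕ) :
    ‖iteratedFDeriv ℝ k (fun y => ∏ i ∈ s, φ i y) x‖ ≤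
      (k + 1 : ℝ) ^ s.card * (k.factorial * A ^ k * ∏ i ∈ s, κ i) := by
  classical
  induction s using Finset.induction_on generalizing k with
  | empty =>
    rcases k with _ | k
    · simp
    · simp only [Finset.prod_empty]
      rw [iteratedFDeriv_const_of_ne (Nat.succ_ne_zero k), Pi.zero_apply, norm_zero]
      positivity
  | insert i s hi ih =>
    simp only [Finset.prod_insert hi, Finset.card_insert_of_notMem hi]
    have hP : 0 ≤ ∏ i ∈ s, κ i := Finset.prod_nonneg fun i _ => hκ i
    refine (norm_iteratedFDeriv_mul_le (hφ i) (contDiff_prod fun i _ => hφ i) x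
      (n := k) (by exact_mod_cast le_top)).trans ?_
    have hterm : ∀ l ∈ Finset.range (k + 1), (k.choose l : ℝ) * ‖iteratedFDeriv ℝ l (φ i) x‖ *
        ‖iteratedFDeriv ℝ (k - l) (fun y => ∏ i ∈ s, φ i y) x‖ ≤
        (k + 1 : ℝ) ^ s.card * (k.factorial * A ^ k * (κ i * ∏ i ∈ s, κ i)) := by
      intro l hl
      have hlk : l ≤ k := Nat.lt_succ_iff.1 (Finset.mem_range.1 hl)
      have h1 : ((k - l : ℕ) + 1 : ℝ) ^ s.card ≤ (k + 1 : ℝ) ^ s.card := by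
        gcongr; exact Nat.sub_le k l
      calc _ ≤ (k.choose l : ℝ) * (l.factorial * A ^ l * κ i) * (((k - l : ℕ) + 1 : ℝ) ^ s.card *
            ((k - l).factorial * A ^ (k - l) * ∏ i ∈ s, κ i)) := by
            gcongr
            · exact mul_nonneg (Nat.cast_nonneg _)
                (mul_nonneg (by positivity) (hκ i))
            · exact h i l
            · exact ih (k - l)
        _ = ((k - l : ℕ) + 1 : ℝ) ^ s.card * (((k.choose l * l.factorial * (k - l).factorial : ℕ) : ℝ)
            * A ^ (l + (k - l)) * (κ i * ∏ i ∈ s, κ i)) := by push_cast; ring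
        _ ≤ _ := by
            rw [Nat.choose_mul_factorial_mul_factorial hlk, Nat.add_sub_cancel' hlk]
            refine mul_le_mul_of_nonneg_right h1 ?_
            exact mul_nonneg (by positivity) (mul_nonneg (hκ i) hP)
    refine (Finset.sum_le_card_nsmul _ _ _ hterm).trans_eq ?_
    rw [Finset.card_range, nsmul_eq_mul]
    push_cast; ring

lemma norm_cos_le_exp_abs_im (w : ℂ) : ‖Complex.cos w‖ ≤ Real.exp |w.im| := by
  have h1 : ‖Complex.exp (w * Complex.I)‖ ≤ Real.exp |w.im| := by
    rw [Complex.norm_exp, Real.exp_le_exp]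
    simpa using neg_le_abs w.im
  have h2 : ‖Complex.exp (-w * Complex.I)‖ ≤ Real.exp |w.im| := by
    rw [Complex.norm_exp, Real.exp_le_exp]
    simpa using le_abs_self w.im
  rw [Complex.cos, norm_div, Complex.norm_ofNat, div_le_iff₀ two_pos]
  linarith [norm_add_le (Complex.exp (w * Complex.I)) (Complex.exp (-w * Complex.I))]

lemma norm_chebyshev_eval_le {t r : ℝ} (ht : |t| ≤ 1 / 2) (hr : r ≤ 1 / 4) (m : ℤ) {z : ℂ}
    (hz : ‖z - t‖ ≤ r) :
    ‖(Polynomial.Chebyshev.T ℂ m).eval z‖ ≤ Real.exp (2 * r * |(m : ℝ)|) := by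
  obtain ⟨w, rfl⟩ := Complex.cos_surjective z
  have hre := (Complex.abs_re_le_norm _).trans hz
  have him := (Complex.abs_im_le_norm _).trans hz
  have hcos : Complex.cos w = ((Real.cos w.re * Real.cosh w.im : ℝ) : ℂ) -
      ((Real.sin w.re * Real.sinh w.im : ℝ) : ℂ) * Complex.I := by
    rw [Complex.cos_eq]; push_cast; ring
  rw [hcos] at hre him
  simp only [Complex.sub_re, Complex.ofReal_re, Complex.mul_re, Complex.I_re, mul_zero,
    Complex.ofReal_im, Complex.I_im, mul_one, sub_zero, Complex.sub_im, Complex.mul_im,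
    zero_sub, add_zero, abs_neg, abs_mul] at hre him
  have hc1 : |Real.cos w.re| ≤ 3 / 4 := by
    have h1 : |Real.cos w.re| ≤ |Real.cos w.re * Real.cosh w.im| := by
      rw [abs_mul, abs_of_pos (Real.cosh_pos w.im)]
      exact le_mul_of_one_le_right (abs_nonneg _) (Real.one_le_cosh _)
    have h2 := abs_sub_abs_le_abs_sub (Real.cos w.re * Real.cosh w.im) t
    linarith
  have hs : 1 / 2 ≤ |Real.sin w.re| := by
    refine abs_le_of_sq_le_sq' ?_ (abs_nonneg _) |>.2
    have h3 := Real.sin_sq_add_cos_sq w.re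
    have h4 : Real.cos w.re ^ 2 ≤ (3 / 4) ^ 2 := by
      rw [← sq_abs (Real.cos w.re)]
      gcongr
    rw [sq_abs]
    linarith
  have hb : |w.im| ≤ 2 * r := by
    have h5 : |w.im| ≤ |Real.sinh w.im| := by
      rw [Real.abs_sinh]
      exact Real.self_le_sinh_iff.2 (abs_nonneg _)
    nlinarith [abs_nonneg (Real.sinh w.im)]
  rw [Polynomial.Chebyshev.T_complex_cos]
  refine (norm_cos_le_exp_abs_im _).trans (Real.exp_le_exp.2 ?_)
  have : ((m : ℂ) * w).im = m * w.im := by simp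
  rw [this, abs_mul, mul_comm]
  gcongr

lemma iteratedDeriv_eval_ofReal (P : Polynomial ℂ) (k : ℕ) :
    iteratedDeriv k (fun s : ℝ => P.eval (s : ℂ)) =
      fun s : ℝ => (Polynomial.derivative^[k] P).eval (s : ℂ) := by
  induction k with
  | zero => rfl
  | succ k ih =>
    rw [iteratedDeriv_succ, ih]
    funext s
    rw [Function.iterate_succ_apply']
    exact ((Polynomial.hasDerivAt _ _).comp_ofReal).deriv

lemma iteratedDeriv_eval (P : Polynomial ℂ) (k : ℕ) :
    iteratedDeriv k (fun z => P.eval z) = fun z => (Polynomial.derivative^[k] P).eval z := by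
  induction k with
  | zero => rfl
  | succ k ih =>
    rw [iteratedDeriv_succ, ih]
    funext s
    rw [Function.iterate_succ_apply', Polynomial.deriv]

lemma norm_iteratedDeriv_chebyshev_le {t r : ℝ} (ht : |t| ≤ 1 / 2) (hr : 0 < r) (hr' : r ≤ 1 / 4)
    (m : ℤ) (k : ℕ) :
    ‖iteratedDeriv k (fun s : ℝ => (Polynomial.Chebyshev.T ℂ m).eval (s : ℂ)) t‖ ≤
      k.factorial * r⁻¹ ^ k * Real.exp (2 * r * |(m : ℝ)|) := by
  have h := Complex.norm_iteratedDeriv_le_of_forall_mem_sphere_norm_le (c := (t : ℂ)) k hr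
    (f := fun z => (Polynomial.Chebyshev.T ℂ m).eval z)
    (Polynomial.differentiable _).diffContOnCl
    (fun z hz => norm_chebyshev_eval_le ht hr' m (mem_sphere_iff_norm.1 hz).le)
  rw [iteratedDeriv_eval] at h
  rw [iteratedDeriv_eval_ofReal]
  refine h.trans_eq ?_
  rw [inv_pow]
  ring

/-- The multivariate Chebyshev polynomials, as functions on Euclidean space. -/
def chebyshevProd {d : ℕ} (m : Fin d → ℤ) (y : EuclideanSpace ℝ (Fin d)) : ℂ :=
  ∏ i, (Polynomial.Chebyshev.T ℂ (m i)).eval ((y i : ℝ) : ℂ)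

lemma contDiff_eval_ofReal (P : Polynomial ℂ) :
    ContDiff ℝ (⊤ : ℕ∞) fun s : ℝ => P.eval (s : ℂ) := by
  have h1 : ContDiff ℂ (⊤ : ℕ∞) fun z : ℂ => P.eval z := by
    simpa using P.contDiff_aeval (𝕜 := ℂ) (⊤ : ℕ∞)
  exact (h1.restrict_scalars ℝ).comp Complex.ofRealCLM.contDiff

lemma contDiff_chebyshevProd {d : ℕ} (m : Fin d → ℤ) :
    ContDiff ℝ (⊤ : ℕ∞) (chebyshevProd m) :=
  contDiff_prod fun i _ => (contDiff_eval_ofReal _).comp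
    (EuclideanSpace.proj i : EuclideanSpace ℝ (Fin d) →L[ℝ] ℝ).contDiff

lemma norm_iteratedFDeriv_chebyshevProd_le_exp {d : ℕ} (m : Fin d → ℤ)
    {y : EuclideanSpace ℝ (Fin d)} (hy : ∀ i, |y i| ≤ 1 / 2) {r : ℝ} (hr : 0 < r) (hr' : r ≤ 1 / 4)
    (k : ℕ) :
    ‖iteratedFDeriv ℝ k (chebyshevProd m) y‖ ≤
      (k + 1 : ℝ) ^ d * (k.factorial * r⁻¹ ^ k * Real.exp (2 * r * ‖m‖) ^ d) := by
  have h := norm_iteratedFDeriv_prod_le_factorial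
    (φ := fun i (y : EuclideanSpace ℝ (Fin d)) =>
      (Polynomial.Chebyshev.T ℂ (m i)).eval ((y i : ℝ) : ℂ)) (x := y) (A := r⁻¹)
    (κ := fun _ => Real.exp (2 * r * ‖m‖))
    (fun i => (contDiff_eval_ofReal _).comp
      (EuclideanSpace.proj i : EuclideanSpace ℝ (Fin d) →L[ℝ] ℝ).contDiff)
    (by positivity) (fun _ => (Real.exp_pos _).le) ?_ Finset.univ k
  · unfold chebyshevProd
    simpa using h
  · intro i k
    let L := (EuclideanSpace.proj i : EuclideanSpace ℝ (Fin d) →L[ℝ] ℝ)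
    have hL : ‖L‖ ≤ 1 := L.opNorm_le_bound zero_le_one fun x => by
      rw [one_mul]; exact PiLp.norm_apply_le x i
    have h1 := L.iteratedFDeriv_comp_right (contDiff_eval_ofReal (Polynomial.Chebyshev.T ℂ (m i)))
      y (i := k) (by exact_mod_cast le_top)
    change ‖iteratedFDeriv ℝ k ((fun s : ℝ => (Polynomial.Chebyshev.T ℂ (m i)).eval (s : ℂ)) ∘ L)
      y‖ ≤ _
    rw [h1]
    refine (ContinuousMultilinearMap.norm_compContinuousLinearMap_le _ _).trans ?_
    rw [norm_iteratedFDeriv_eq_norm_iteratedDeriv]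
    have h2 : ∏ _i : Fin k, ‖L‖ ≤ 1 := Finset.prod_le_one (fun _ _ => norm_nonneg _) fun _ _ => hL
    refine (mul_le_of_le_one_right (norm_nonneg _) h2).trans ?_
    refine (norm_iteratedDeriv_chebyshev_le (hy i) hr hr' (m i) k).trans ?_
    have h3 : |(m i : ℝ)| ≤ ‖m‖ := by
      rw [← Int.norm_eq_abs]; exact norm_le_pi_norm m i
    gcongr

lemma norm_iteratedFDeriv_chebyshevProd_le {d : ℕ} (m : Fin d → ℤ)
    {y : EuclideanSpace ℝ (Fin d)} (hy : ∀ i, |y i| ≤ 1 / 2) (k : ℕ) :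
    ‖iteratedFDeriv ℝ k (chebyshevProd m) y‖ ≤
      (Real.exp 3 ^ d) ^ (k + 1) * (‖m‖ ^ k + k.factorial * 4 ^ k) := by
  have hM : 0 ≤ ‖m‖ := norm_nonneg m
  have hk1 : (k + 1 : ℝ) ^ d ≤ Real.exp (k + 1) ^ d := by
    gcongr
    linarith [Real.add_one_le_exp ((k : ℝ) + 1)]
  have hQ : (Real.exp 3 ^ d) ^ (k + 1) = Real.exp (k + 1) ^ d * Real.exp (2 * (k + 1)) ^ d := by
    rw [← mul_pow, ← Real.exp_add, ← pow_mul, mul_comm d, pow_mul, ← Real.exp_nat_mul]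
    congr 2; push_cast; ring
  rw [hQ, mul_assoc]
  by_cases hcase : 4 * (k + 1 : ℝ) ≤ ‖m‖
  · have hM0 : 0 < ‖m‖ := lt_of_lt_of_le (by positivity) hcase
    have hr' : (k + 1 : ℝ) / ‖m‖ ≤ 1 / 4 := by
      rw [div_le_div_iff₀ hM0 (by norm_num)]; linarith
    refine (norm_iteratedFDeriv_chebyshevProd_le_exp m hy (by positivity) hr' k).trans ?_
    have h1 : 2 * ((k + 1 : ℝ) / ‖m‖) * ‖m‖ = 2 * (k + 1) := by field_simp
    have h2 : (k.factorial : ℝ) * ((k + 1 : ℝ) / ‖m‖)⁻¹ ^ k ≤ ‖m‖ ^ k := by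
      rw [inv_div, div_pow, mul_div_assoc', div_le_iff₀ (by positivity), mul_comm]
      gcongr
      exact_mod_cast k.factorial_le_pow.trans (Nat.pow_le_pow_left (Nat.le_succ k) k)
    rw [h1]
    refine mul_le_mul hk1 ?_ (by positivity) (by positivity)
    rw [mul_comm (Real.exp (2 * (k + 1)) ^ d)]
    refine mul_le_mul_of_nonneg_right (h2.trans ?_) (by positivity)
    have : (0 : ℝ) ≤ k.factorial * 4 ^ k := by positivity
    linarith
  · refine (norm_iteratedFDeriv_chebyshevProd_le_exp m hy (by norm_num : (0 : ℝ) < 1 / 4) le_rfl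
      k).trans ?_
    rw [mul_comm (Real.exp (2 * (k + 1)) ^ d), one_div, inv_inv]
    have h0 : (0 : ℝ) ≤ ‖m‖ ^ k := by positivity
    refine mul_le_mul hk1 (mul_le_mul (by linarith) ?_ (by positivity) (by positivity))
      (by positivity) (by positivity)
    exact pow_le_pow_left₀ (Real.exp_pos _).le (Real.exp_le_exp.2 (by linarith)) d

lemma IsWeightFunction.exists_exp_mul_norm_chebyshevProd_le {ω : ℝ → ℝ} (hω : IsWeightFunction ω)
    (d : ℕ) {c : ℝ} (hc : 0 < c) {R : ℝ} (hR : 1 ≤ R) :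
    ∃ C : ℝ, 0 < C ∧ ∃ ρ : ℝ, 0 < ρ ∧ ∀ (m : Fin d → ℤ) (y : EuclideanSpace ℝ (Fin d)),
      (∀ i, |y i| ≤ 1 / 2) → ∀ k : ℕ,
        Real.exp (-c * ω ‖m‖) * (R ^ k * ‖iteratedFDeriv ℝ k (chebyshevProd m) y‖) ≤
          C * bmt ω ρ k * Real.exp (-(c / 2) * ω ‖m‖) := by
  obtain ⟨ρ₁, hρ₁, C₁, hC₁, hfac⟩ := hω.exists_factorial_le
  set Q : ℝ := Real.exp 3 ^ d with hQ
  have hQ1 : 1 ≤ Q := one_le_pow₀ (Real.one_le_exp (by norm_num))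
  have hρ₀ : 0 < 2 / c := by positivity
  set ρ₂ := max (2 / c) ρ₁ with hρ₂
  have hρ₂0 : 0 < ρ₂ := lt_max_of_lt_left hρ₀
  have hA : 1 ≤ 4 * Q * R := by nlinarith
  obtain ⟨ρ, hρ, C₂, hC₂, hpow⟩ := hω.exists_pow_mul_bmt_le hρ₂0 hA
  have hρ0 : 0 < ρ := hρ₂0.trans_le hρ
  set S := Real.exp (c / 2 * ω 1) + C₁ with hS
  refine ⟨Q * S * C₂, by positivity, ρ, hρ0, fun m y hy k => ?_⟩
  have hM : 0 ≤ ‖m‖ := norm_nonneg m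
  have hωM := hω.nonneg _ hM
  have hω1 := hω.nonneg 1 zero_le_one
  have hbp := bmt_pos ω ρ₂ k
  have hmax : ω (max 1 ‖m‖) ≤ ω 1 + ω ‖m‖ := by
    rcases max_choice 1 ‖m‖ with h | h <;> rw [h] <;> linarith
  have h1 : Real.exp (-c * ω ‖m‖) * ‖m‖ ^ k ≤
      Real.exp (c / 2 * ω 1) * bmt ω ρ₂ k * Real.exp (-(c / 2) * ω ‖m‖) := by
    have h2 : ‖m‖ ^ k ≤ bmt ω ρ₂ k * Real.exp (c / 2 * (ω 1 + ω ‖m‖)) := by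
      calc ‖m‖ ^ k ≤ (max 1 ‖m‖) ^ k := by gcongr; exact le_max_right _ _
        _ ≤ bmt ω (2 / c) k * Real.exp (ω (max 1 ‖m‖) / (2 / c)) :=
            hω.pow_le_bmt_mul hρ₀ k (le_max_left _ _)
        _ ≤ _ := by
            gcongr
            · exact hω.bmt_mono hρ₀ (le_max_left _ _) k
            · rw [div_div_eq_mul_div, div_le_iff₀ two_pos]
              nlinarith
    calc _ ≤ Real.exp (-c * ω ‖m‖) * (bmt ω ρ₂ k * Real.exp (c / 2 * (ω 1 + ω ‖m‖))) := by gcongr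
      _ = bmt ω ρ₂ k * Real.exp (-c * ω ‖m‖ + c / 2 * (ω 1 + ω ‖m‖)) := by
          rw [Real.exp_add]; ring
      _ = bmt ω ρ₂ k * Real.exp (c / 2 * ω 1 + -(c / 2) * ω ‖m‖) := by congr 2; ring
      _ = _ := by rw [Real.exp_add]; ring
  have h3 : Real.exp (-c * ω ‖m‖) * k.factorial ≤
      C₁ * bmt ω ρ₂ k * Real.exp (-(c / 2) * ω ‖m‖) := by
    rw [mul_comm]
    refine mul_le_mul ((hfac k).trans ?_) (Real.exp_le_exp.2 (by nlinarith)) (Real.exp_pos _).le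
      (by positivity)
    gcongr
    exact hω.bmt_mono hρ₁ (le_max_right _ _) k
  have h4 : (1 : ℝ) ≤ 4 ^ k := one_le_pow₀ (by norm_num)
  have h5 : Real.exp (-c * ω ‖m‖) * (‖m‖ ^ k + k.factorial * 4 ^ k) ≤
      4 ^ k * (S * bmt ω ρ₂ k * Real.exp (-(c / 2) * ω ‖m‖)) := by
    have h6 : Real.exp (-c * ω ‖m‖) * ‖m‖ ^ k ≤ 4 ^ k * (Real.exp (-c * ω ‖m‖) * ‖m‖ ^ k) :=
      le_mul_of_one_le_left (by positivity) h4
    calc _ ≤ 4 ^ k * (Real.exp (-c * ω ‖m‖) * ‖m‖ ^ k + Real.exp (-c * ω ‖m‖) * k.factorial) := by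
          linarith
      _ ≤ 4 ^ k * (Real.exp (c / 2 * ω 1) * bmt ω ρ₂ k * Real.exp (-(c / 2) * ω ‖m‖) +
          C₁ * bmt ω ρ₂ k * Real.exp (-(c / 2) * ω ‖m‖)) := by gcongr
      _ = _ := by rw [hS]; ring
  calc _ ≤ Real.exp (-c * ω ‖m‖) * (R ^ k * (Q ^ (k + 1) * (‖m‖ ^ k + k.factorial * 4 ^ k))) := by
        gcongr
        exact norm_iteratedFDeriv_chebyshevProd_le m hy k
    _ = R ^ k * Q ^ (k + 1) * (Real.exp (-c * ω ‖m‖) * (‖m‖ ^ k + k.factorial * 4 ^ k)) := by ring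
    _ ≤ R ^ k * Q ^ (k + 1) * (4 ^ k * (S * bmt ω ρ₂ k * Real.exp (-(c / 2) * ω ‖m‖))) := by
        gcongr
    _ = Q * S * ((4 * Q * R) ^ k * bmt ω ρ₂ k) * Real.exp (-(c / 2) * ω ‖m‖) := by
        rw [mul_pow, mul_pow]; ring
    _ ≤ Q * S * (C₂ * bmt ω ρ k) * Real.exp (-(c / 2) * ω ‖m‖) := by
        exact mul_le_mul_of_nonneg_right (mul_le_mul_of_nonneg_left (hpow k) (by positivity))
          (Real.exp_pos _).le
    _ = _ := by ring

lemma continuousOn_of_pow_of_pow_succ {X : Type*} [TopologicalSpace X] {f : X → ℂ} {U : Set X}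
    {j : ℕ} (hj : 1 ≤ j) (h₁ : ContinuousOn (fun x => f x ^ j) U)
    (h₂ : ContinuousOn (fun x => f x ^ (j + 1)) U) : ContinuousOn f U := by
  intro x hx
  by_cases hfx : f x = 0
  · have h := h₁ x hx
    rw [ContinuousWithinAt, Metric.tendsto_nhds] at h ⊢
    intro ε hε
    filter_upwards [h (ε ^ j) (by positivity)] with y hy
    rw [hfx, zero_pow (by omega), dist_zero_right, norm_pow] at hy
    rw [hfx, dist_zero_right]
    exact lt_of_pow_lt_pow_left₀ j hε.le hy
  · have hne : f x ^ j ≠ 0 := pow_ne_zero j hfx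
    refine ((h₂ x hx).div (h₁ x hx) hne).congr_of_eventuallyEq ?_ ?_
    · filter_upwards [(h₁ x hx).eventually_ne hne] with y hy
      rw [Pi.div_apply, pow_succ, mul_div_cancel_left₀ _ hy]
    · rw [Pi.div_apply, pow_succ, mul_div_cancel_left₀ _ hne]

section LineRestriction

variable {E F : Type*} [NormedAddCommGroup E] [NormedSpace ℝ E] [NormedAddCommGroup F]
  [NormedSpace ℝ F] {g : E → F} {U : Set E}

lemma hasDerivAt_iteratedFDeriv_line (hU : IsOpen U) (hg : ContDiffOn ℝ (⊤ : ℕ∞) g U) (p v : E)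
    {s : ℝ} (hs : p + s • v ∈ U) (k : ℕ) :
    HasDerivAt (fun t : ℝ => iteratedFDeriv ℝ k g (p + t • v) (fun _ => v))
      (iteratedFDeriv ℝ (k + 1) g (p + s • v) (fun _ => v)) s := by
  have hd : DifferentiableAt ℝ (iteratedFDeriv ℝ k g) (p + s • v) :=
    (hg.contDiffAt (hU.mem_nhds hs)).differentiableAt_iteratedFDeriv
      (WithTop.coe_lt_coe.2 (ENat.natCast_lt_top k))
  have hl : HasDerivAt (fun t : ℝ => p + t • v) v s := by
    simpa using ((hasDerivAt_id s).smul_const v).const_add p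
  have h := hd.hasFDerivAt.comp_hasDerivAt s hl
  have h' := (ContinuousMultilinearMap.apply ℝ (fun _ : Fin k => E) F
    (fun _ => v)).hasFDerivAt.comp_hasDerivAt s h
  rw [iteratedFDeriv_succ_apply_left]
  exact h'

lemma norm_iteratedFDeriv_apply_const_le {v : E} (hv : ‖v‖ ≤ 1) (k : ℕ) (x : E) :
    ‖iteratedFDeriv ℝ k g x (fun _ => v)‖ ≤ ‖iteratedFDeriv ℝ k g x‖ := by
  refine (ContinuousMultilinearMap.le_opNorm _ _).trans ?_
  exact mul_le_of_le_one_right (norm_nonneg _) (Finset.prod_le_one (fun _ _ => norm_nonneg _)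
    fun _ _ => hv)

end LineRestriction

lemma toLp_update_eq {d : ℕ} (y : Fin d → ℝ) (i : Fin d) (s : ℝ) :
    WithLp.toLp 2 (Function.update y i s) =
      WithLp.toLp 2 (Function.update y i 0) + s • EuclideanSpace.single i (1 : ℝ) := by
  ext l
  by_cases h : l = i
  · subst h; simp
  · simp [h]

lemma update_mem_Icc {d : ℕ} {y : Fin d → ℝ} (hy : y ∈ Icc (-1 : Fin d → ℝ) 1) (i : Fin d) {s : ℝ}
    (hs : s ∈ Icc (-1 : ℝ) 1) : Function.update y i s ∈ Icc (-1 : Fin d → ℝ) 1 := by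
  constructor
  · exact le_update_iff.2 ⟨hs.1, fun l _ => hy.1 l⟩
  · exact update_le_iff.2 ⟨hs.2, fun l _ => hy.2 l⟩

lemma IsWeightFunction.exists_norm_cosCoeff_update_le {ω : ℝ → ℝ} (hω : IsWeightFunction ω)
    {d j : ℕ} (hj : 1 ≤ j) {U : Set (EuclideanSpace ℝ (Fin d))} (hU : IsOpen U)
    {f : EuclideanSpace ℝ (Fin d) → ℂ}
    (h₁ : RoumieuW ω U (fun x => f x ^ j)) (h₂ : RoumieuW ω U (fun x => f x ^ (j + 1)))
    {x₀ : EuclideanSpace ℝ (Fin d)} {r : ℝ} (hr : 0 < r) (hr1 : r ≤ 1)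
    (hcube : ∀ y ∈ Icc (-1 : Fin d → ℝ) 1, x₀ + r • WithLp.toLp 2 y ∈ U) :
    ContinuousOn (fun y : Fin d → ℝ => f (x₀ + r • WithLp.toLp 2 y)) (Icc (-1) 1) ∧
    ∃ A : ℝ, 0 < A ∧ ∃ c : ℝ, 0 < c ∧ ∀ i, ∀ y ∈ Icc (-1 : Fin d → ℝ) 1, ∀ m : ℤ,
      ‖cosCoeff (fun s => f (x₀ + r • WithLp.toLp 2 (Function.update y i s))) m‖ ≤
        A * Real.exp (-c * ω |(m : ℝ)|) := by
  have hfU : ContinuousOn f U :=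
    continuousOn_of_pow_of_pow_succ hj h₁.1.continuousOn h₂.1.continuousOn
  have hφ : Continuous fun y : Fin d → ℝ => x₀ + r • WithLp.toLp 2 y := by fun_prop
  have hF : ContinuousOn (fun y : Fin d → ℝ => f (x₀ + r • WithLp.toLp 2 y)) (Icc (-1) 1) :=
    hfU.comp hφ.continuousOn hcube
  refine ⟨hF, ?_⟩
  set K := (fun y : Fin d → ℝ => x₀ + r • WithLp.toLp 2 y) '' Icc (-1) 1 with hK
  have hKc : IsCompact K := isCompact_Icc.image hφ
  have hKU : K ⊆ U := image_subset_iff.2 hcube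
  obtain ⟨B, hB⟩ := hKc.exists_bound_of_continuousOn (hfU.mono hKU)
  obtain ⟨C₁, hC₁, ρ₁, hρ₁, hb₁⟩ := h₁.2 K hKU hKc
  obtain ⟨C₂, hC₂, ρ₂, hρ₂, hb₂⟩ := h₂.2 K hKU hKc
  have hρ : 0 < max ρ₁ ρ₂ := lt_max_of_lt_left hρ₁
  obtain ⟨A, hA, c, hc, H⟩ := hω.exists_norm_cosCoeff_le_of_pow hj (le_max_right B 0) hρ
    (max C₁ C₂)
  refine ⟨A, hA, c, hc, fun i y hy m => ?_⟩
  set p := x₀ + r • WithLp.toLp 2 (Function.update y i 0) with hp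
  set v := r • EuclideanSpace.single i (1 : ℝ) with hv
  have hline : ∀ s : ℝ, x₀ + r • WithLp.toLp 2 (Function.update y i s) = p + s • v := by
    intro s
    rw [toLp_update_eq, hp, hv, smul_add, smul_comm s r, add_assoc]
  have hv1 : ‖v‖ ≤ 1 := by
    rw [hv, norm_smul, PiLp.norm_single]; simpa [abs_of_pos hr] using hr1
  simp only [hline]
  have hmemK : ∀ s ∈ Icc (-1 : ℝ) 1, p + s • v ∈ K := fun s hs =>
    hline s ▸ mem_image_of_mem _ (update_mem_Icc hy i hs)
  have hbound : ∀ {g : EuclideanSpace ℝ (Fin d) → ℂ} {C ρ : ℝ}, 0 < C → 0 < ρ →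
      C ≤ max C₁ C₂ → ρ ≤ max ρ₁ ρ₂ →
      (∀ x ∈ K, ∀ k : ℕ, ‖iteratedFDerivWithin ℝ k g U x‖ ≤ C * bmt ω ρ k) →
      ∀ k : ℕ, ∀ s ∈ Icc (-1 : ℝ) 1, ‖iteratedFDeriv ℝ k g (p + s • v) (fun _ => v)‖ ≤
        max C₁ C₂ * bmt ω (max ρ₁ ρ₂) k := by
    intro g C ρ hC hρ0 hCC hρρ hb k s hs
    refine (norm_iteratedFDeriv_apply_const_le hv1 k _).trans ?_
    rw [← iteratedFDerivWithin_of_isOpen k hU (hKU (hmemK s hs))]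
    exact (hb _ (hmemK s hs) k).trans (mul_le_mul hCC (hω.bmt_mono hρ0 hρρ k)
      (bmt_pos ω ρ k).le (hC.le.trans hCC))
  refine H (fun s => f (p + s • v))
    (fun k s => iteratedFDeriv ℝ k (fun x => f x ^ j) (p + s • v) (fun _ => v))
    (fun k s => iteratedFDeriv ℝ k (fun x => f x ^ (j + 1)) (p + s • v) (fun _ => v))
    ?_ ?_ ?_ ?_ ?_ ?_ ?_ ?_ m
  · exact hfU.comp (by fun_prop) fun s hs => hKU (hmemK s hs)
  · exact fun s hs => (hB _ (hmemK s hs)).trans (le_max_left _ _)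
  · exact fun s _ => iteratedFDeriv_zero_apply _
  · exact fun s _ => iteratedFDeriv_zero_apply _
  · exact fun k s hs => hasDerivAt_iteratedFDeriv_line hU h₁.1 p v (hKU (hmemK s hs)) k
  · exact fun k s hs => hasDerivAt_iteratedFDeriv_line hU h₂.1 p v (hKU (hmemK s hs)) k
  · exact hbound hC₁ hρ₁ (le_max_left _ _) (le_max_left _ _) hb₁
  · exact hbound hC₂ hρ₂ (le_max_right _ _) (le_max_right _ _) hb₂

lemma norm_iteratedFDeriv_const_mul_comp_smul_sub {E : Type*} [NormedAddCommGroup E]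
    [NormedSpace ℝ E] {g : E → ℂ} (hg : ContDiff ℝ (⊤ : ℕ∞) g) (a : ℂ) {R : ℝ} (hR : 0 ≤ R)
    (x₀ : E) (k : ℕ) (x : E) :
    ‖iteratedFDeriv ℝ k (fun x => a * g (R • (x - x₀))) x‖ =
      ‖a‖ * (R ^ k * ‖iteratedFDeriv ℝ k g (R • (x - x₀))‖) := by
  have hgk : ContDiff ℝ k g := hg.of_le (by exact_mod_cast le_top)
  have h1 : ContDiff ℝ k fun x => g (R • (x - x₀)) := hgk.comp (by fun_prop)
  have h2 : (fun x => a * g (R • (x - x₀))) = a • fun x => g (R • (x - x₀)) := rfl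
  rw [h2, iteratedFDeriv_const_smul_apply h1.contDiffAt, norm_smul,
    iteratedFDeriv_comp_sub (f := fun z => g (R • z)), iteratedFDeriv_comp_const_smul R hgk,
    norm_smul, norm_pow, Real.norm_of_nonneg hR]

/-- The local form of Joris' theorem. -/
lemma IsWeightFunction.exists_isOpen_norm_iteratedFDerivWithin_le {ω : ℝ → ℝ}
    (hω : IsWeightFunction ω) {d j : ℕ} (hj : 1 ≤ j) {U : Set (EuclideanSpace ℝ (Fin d))}
    (hU : IsOpen U) {f : EuclideanSpace ℝ (Fin d) → ℂ}
    (h₁ : RoumieuW ω U (fun x => f x ^ j)) (h₂ : RoumieuW ω U (fun x => f x ^ (j + 1)))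
    {x₀ : EuclideanSpace ℝ (Fin d)} (hx₀ : x₀ ∈ U) :
    ∃ V, IsOpen V ∧ x₀ ∈ V ∧ ContDiffOn ℝ (⊤ : ℕ∞) f V ∧ ∃ C : ℝ, 0 < C ∧ ∃ ρ : ℝ, 0 < ρ ∧
      ∀ x ∈ V, ∀ k : ℕ, ‖iteratedFDerivWithin ℝ k f V x‖ ≤ C * bmt ω ρ k := by
  obtain ⟨r, hr, hr1, hcube⟩ : ∃ r : ℝ, 0 < r ∧ r ≤ 1 ∧
      ∀ y ∈ Icc (-1 : Fin d → ℝ) 1, x₀ + r • WithLp.toLp 2 y ∈ U := by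
    obtain ⟨ε, hε, hεU⟩ := Metric.isOpen_iff.1 hU x₀ hx₀
    obtain ⟨B, hB⟩ := (isCompact_Icc (a := (-1 : Fin d → ℝ)) (b := 1)).exists_bound_of_continuousOn
      (f := fun y => (WithLp.toLp 2 y : EuclideanSpace ℝ (Fin d))) (by fun_prop)
    have hB0 : 0 < |B| + 1 := by positivity
    refine ⟨min 1 (ε / (|B| + 1)), by positivity, min_le_left _ _, fun y hy => hεU ?_⟩
    rw [Metric.mem_ball, dist_self_add_left, norm_smul, Real.norm_of_nonneg (by positivity)]
    calc _ ≤ ε / (|B| + 1) * |B| := by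
          gcongr
          · exact min_le_right _ _
          · exact (hB y hy).trans (le_abs_self B)
      _ < ε := by
          rw [div_mul_eq_mul_div, div_lt_iff₀ hB0]
          nlinarith
  obtain ⟨hF, A, hA, c, hc, hcoef⟩ := hω.exists_norm_cosCoeff_update_le hj hU h₁ h₂ hr hr1 hcube
  obtain ⟨A', hA', a, ha, hsum⟩ := hω.exists_hasSum_chebyshev hF hA hc hcoef
  have hR : 1 ≤ r⁻¹ := (one_le_inv₀ hr).2 hr1
  obtain ⟨C, hC, ρ, hρ, hcheb⟩ := hω.exists_exp_mul_norm_chebyshevProd_le d hc hR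
  have hS := hω.summable_exp_neg (half_pos hc) d
  have hcoord : ∀ x ∈ Metric.ball x₀ (r / 2), ∀ i, |(r⁻¹ • (x - x₀)) i| ≤ 1 / 2 := by
    intro x hx i
    rw [Metric.mem_ball, dist_eq_norm] at hx
    calc |(r⁻¹ • (x - x₀)) i| ≤ ‖r⁻¹ • (x - x₀)‖ := by
          simpa using PiLp.norm_apply_le (r⁻¹ • (x - x₀)) i
      _ = r⁻¹ * ‖x - x₀‖ := by rw [norm_smul, Real.norm_of_nonneg (by positivity)]
      _ ≤ r⁻¹ * (r / 2) := by gcongr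
      _ = 1 / 2 := by field_simp
  have hu : ∀ k : ℕ, Summable fun m : Fin d → ℤ =>
      A' * (C * bmt ω ρ k * Real.exp (-(c / 2) * ω ‖m‖)) := fun k =>
    (hS.mul_left _).mul_left _
  have key := contDiffOn_of_hasSum_of_summable (f := f) (V := Metric.ball x₀ (r / 2))
    (ψ := fun m x => a m * chebyshevProd m (r⁻¹ • (x - x₀)))
    (fun m => contDiff_const.mul ((contDiff_chebyshevProd m).comp (by fun_prop)))
    Metric.isOpen_ball (convex_ball x₀ _).isPreconnected hu ?_ ?_
  · set T := ∑' m : Fin d → ℤ, Real.exp (-(c / 2) * ω ‖m‖) with hT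
    have hT0 : 0 < T := hS.tsum_pos (fun _ => (Real.exp_pos _).le) 0 (Real.exp_pos _)
    refine ⟨_, Metric.isOpen_ball, Metric.mem_ball_self (half_pos hr), key.1, A' * C * T,
      by positivity, ρ, hρ, fun x hx k => (key.2 k x hx).trans_eq ?_⟩
    rw [tsum_mul_left, tsum_mul_left, ← hT]
    ring
  · intro k m x hx
    rw [norm_iteratedFDeriv_const_mul_comp_smul_sub (contDiff_chebyshevProd m) _ (by positivity)]
    calc _ ≤ A' * Real.exp (-c * ω ‖m‖) *
          (r⁻¹ ^ k * ‖iteratedFDeriv ℝ k (chebyshevProd m) (r⁻¹ • (x - x₀))‖) :=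
        mul_le_mul_of_nonneg_right (ha m) (by positivity)
      _ ≤ _ := by
        rw [mul_assoc]
        exact mul_le_mul_of_nonneg_left (hcheb m _ (hcoord x hx) k) hA'.le
  · intro x hx
    have hy : (r⁻¹ • (x - x₀)).ofLp ∈ Icc (-1 : Fin d → ℝ) 1 := by
      have h := fun i => abs_le.1 ((hcoord x hx i).trans (by norm_num : (1 / 2 : ℝ) ≤ 1))
      exact ⟨fun i => (h i).1, fun i => (h i).2⟩
    have h := hsum _ hy
    rwa [WithLp.toLp_ofLp, smul_inv_smul₀ hr.ne', add_sub_cancel] at h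

lemma IsWeightFunction.roumieuW_of_local {ω : ℝ → ℝ} (hω : IsWeightFunction ω) {E F : Type*}
    [NormedAddCommGroup E] [NormedSpace ℝ E] [NormedAddCommGroup F] [NormedSpace ℝ F]
    {U : Set E} (hU : IsOpen U) {f : E → F}
    (h : ∀ x₀ ∈ U, ∃ V, IsOpen V ∧ x₀ ∈ V ∧ ContDiffOn ℝ (⊤ : ℕ∞) f V ∧ ∃ C : ℝ, 0 < C ∧
      ∃ ρ : ℝ, 0 < ρ ∧ ∀ x ∈ V, ∀ k : ℕ, ‖iteratedFDerivWithin ℝ k f V x‖ ≤ C * bmt ω ρ k) :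
    RoumieuW ω U f := by
  constructor
  · intro x hx
    obtain ⟨V, hV, hxV, hfV, -⟩ := h x hx
    exact (hfV.contDiffAt (hV.mem_nhds hxV)).contDiffWithinAt
  · intro K hKU hK
    suffices H : ∃ C : ℝ, 0 < C ∧ ∃ ρ : ℝ, 0 < ρ ∧ ∀ x ∈ K, ∀ k : ℕ,
        ‖iteratedFDeriv ℝ k f x‖ ≤ C * bmt ω ρ k by
      obtain ⟨C, hC, ρ, hρ, hb⟩ := H
      refine ⟨C, hC, ρ, hρ, fun x hx k => ?_⟩
      rw [iteratedFDerivWithin_of_isOpen k hU (hKU hx)]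
      exact hb x hx k
    refine hK.induction_on (p := fun s => ∃ C : ℝ, 0 < C ∧ ∃ ρ : ℝ, 0 < ρ ∧ ∀ x ∈ s, ∀ k : ℕ,
        ‖iteratedFDeriv ℝ k f x‖ ≤ C * bmt ω ρ k) ⟨1, one_pos, 1, one_pos, by simp⟩ ?_ ?_ ?_
    · rintro s t hst ⟨C, hC, ρ, hρ, hb⟩
      exact ⟨C, hC, ρ, hρ, fun x hx => hb x (hst hx)⟩
    · rintro s t ⟨C₁, hC₁, ρ₁, hρ₁, hb₁⟩ ⟨C₂, hC₂, ρ₂, hρ₂, hb₂⟩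
      refine ⟨max C₁ C₂, lt_max_of_lt_left hC₁, max ρ₁ ρ₂, lt_max_of_lt_left hρ₁, ?_⟩
      rintro x (hx | hx) k
      · exact (hb₁ x hx k).trans (mul_le_mul (le_max_left _ _) (hω.bmt_mono hρ₁ (le_max_left _ _) k)
          (bmt_pos ω ρ₁ k).le (hC₁.le.trans (le_max_left _ _)))
      · exact (hb₂ x hx k).trans (mul_le_mul (le_max_right _ _)
          (hω.bmt_mono hρ₂ (le_max_right _ _) k) (bmt_pos ω ρ₂ k).le
          (hC₂.le.trans (le_max_right _ _)))
    · intro x hx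
      obtain ⟨V, hV, hxV, -, C, hC, ρ, hρ, hb⟩ := h x (hKU hx)
      refine ⟨V, mem_nhdsWithin_of_mem_nhds (hV.mem_nhds hxV), C, hC, ρ, hρ, fun z hz k => ?_⟩
      rw [← iteratedFDerivWithin_of_isOpen k hV hz]
      exact hb z hz k

/-- Joris' theorem for the Roumieu Braun–Meise–Taylor class of a concave weight function. -/
theorem statement4 {d : ℕ} (ω : ℝ → ℝ) (hω : IsWeightFunction ω)
    (hconc : ConcaveOn ℝ (Ici 0) ω)
    (U : Set (EuclideanSpace ℝ (Fin d))) (hU : IsOpen U)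
    (j : ℕ) (hj : 1 ≤ j) (f : EuclideanSpace ℝ (Fin d) → ℂ)
    (h1 : RoumieuW ω U (fun x => f x ^ j))
    (h2 : RoumieuW ω U (fun x => f x ^ (j + 1))) :
    RoumieuW ω U f := by
  exact hω.roumieuW_of_local hU fun _ hx =>
    hω.exists_isOpen_norm_iteratedFDerivWithin_le hj hU h1 h2 hx

end JorisPaper
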